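/- arXiv:2108.09244 — 3 statements merged into one kernel-verified Lean document; each statement's English description precedes it below -/
import Mathlib

section
/- Let b ∈ (0,1/2), let a > 0 satisfy a = 1 − b or a = 1/2, and let s be a real number with −2a < s < b. Then ∫₀^∞ ∫₀^∞ (x+y)^s f_{a,b}(x) f_{a,b}(y) dx dy = [Γ(2a+s)Γ(b−s)/(Γ(2a)Γ(b))] · [Γ(a+1/2)/(Γ(a)Γ(1/2))] · [Γ(1/2)/(Γ(b)Γ(1/2−b))] · ∫₀^1 ∫₀^1 u^{a−1}(1−u)^{−1/2} v^{b−1}(1−v)^{−1/2−b} (1+√(u/v))^s du dv. (This is the Mellin-transform form of the identity in law B'_{a,b} + B'_{a,b} = B'_{2a,b} × (1 + √(B_{a,1/2}/B_{b,1/2−b})) of Theorem B.) -/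
open MeasureTheory Set

/-- The beta prime density with parameters `a, b`. -/
noncomputable def betaPrimeDensity (a b x : ℝ) : ℝ :=
  Real.Gamma (a + b) / (Real.Gamma a * Real.Gamma b) * x ^ (a - 1) * (1 + x) ^ (-(a + b))

open scoped ENNReal

/-- Change of variables for a bijection between subsets of the line with an explicit inverse. -/
theorem setLIntegral_eq_of_invOn {s t : Set ℝ} {φ φ' ψ : ℝ → ℝ} (hs : MeasurableSet s)
    (hφ : ∀ x ∈ s, HasDerivAt φ (φ' x) x) (hst : ∀ x ∈ s, φ x ∈ t ∧ ψ (φ x) = x)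
    (hts : ∀ y ∈ t, ψ y ∈ s ∧ φ (ψ y) = y) (f : ℝ → ℝ≥0∞) :
    ∫⁻ y in t, f y = ∫⁻ x in s, ENNReal.ofReal |φ' x| * f (φ x) := by
  have himage : Set.image φ s = t := by
    ext y
    constructor
    · rintro ⟨x, hx, rfl⟩
      exact (hst x hx).1
    · exact fun hy => ⟨ψ y, hts y hy⟩
  have hinj : InjOn φ s := fun x hx y hy hxy => by
    rw [← (hst x hx).2, ← (hst y hy).2, hxy]
  rw [← himage]
  exact lintegral_image_eq_lintegral_abs_deriv_mul hs (fun x hx => (hφ x hx).hasDerivWithinAt)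
    hinj f

/-- The substitution `x ↦ k * x ^ p` on the positive half-line. -/
theorem setLIntegral_Ioi_comp_mul_rpow {k p : ℝ} (hk : 0 < k) (hp : p ≠ 0) (f : ℝ → ℝ≥0∞) :
    ∫⁻ x in Ioi (0 : ℝ), f x
      = ∫⁻ x in Ioi (0 : ℝ), ENNReal.ofReal (k * |p| * x ^ (p - 1)) * f (k * x ^ p) := by
  rw [setLIntegral_eq_of_invOn (s := Ioi 0) (φ := fun x => k * x ^ p)
    (φ' := fun x => k * (p * x ^ (p - 1))) (ψ := fun y => (y / k) ^ p⁻¹) measurableSet_Ioi]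
  · refine setLIntegral_congr_fun measurableSet_Ioi fun x (hx : 0 < x) => ?_
    simp only [abs_mul, abs_of_pos hk, abs_of_pos (Real.rpow_pos_of_pos hx _), mul_assoc]
  · exact fun x (hx : 0 < x) => (Real.hasDerivAt_rpow_const (Or.inl hx.ne')).const_mul k
  · intro x (hx : 0 < x)
    refine ⟨mem_Ioi.2 (by positivity), ?_⟩
    simp only [mul_div_cancel_left₀ _ hk.ne']
    exact Real.rpow_rpow_inv hx.le hp
  · intro y (hy : 0 < y)
    refine ⟨mem_Ioi.2 (by positivity), ?_⟩
    simp only [Real.rpow_inv_rpow (div_pos hy hk).le hp]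
    field_simp

/-- The substitution `x ↦ k * x` on the positive half-line. -/
theorem setLIntegral_Ioi_comp_mul {k : ℝ} (hk : 0 < k) (f : ℝ → ℝ≥0∞) :
    ∫⁻ x in Ioi (0 : ℝ), f x = ∫⁻ x in Ioi (0 : ℝ), ENNReal.ofReal k * f (k * x) := by
  rw [setLIntegral_Ioi_comp_mul_rpow hk one_ne_zero]
  simp

/-- The Gamma integral with a rate parameter. -/
theorem setLIntegral_rpow_mul_exp_neg_mul {p r : ℝ} (hp : 0 < p) (hr : 0 < r) :
    ∫⁻ x in Ioi (0 : ℝ), ENNReal.ofReal (x ^ (p - 1) * Real.exp (-(r * x)))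
      = ENNReal.ofReal (r ^ (-p) * Real.Gamma p) := by
  have hval := Real.integral_rpow_mul_exp_neg_mul_Ioi hp hr
  rw [← ofReal_integral_eq_lintegral_ofReal, hval, one_div, Real.inv_rpow hr.le,
    Real.rpow_neg hr.le]
  · refine Integrable.of_integral_ne_zero ?_
    rw [hval]
    have := Real.Gamma_pos_of_pos hp
    positivity
  · filter_upwards [ae_restrict_mem measurableSet_Ioi] with x hx
    have hx' : (0 : ℝ) < x := hx
    simp only [Pi.zero_apply]
    positivity

/-- The beta integral of the second kind, with two scale parameters. -/
theorem setLIntegral_rpow_mul_add_mul_rpow {β γ X Y : ℝ} (hβ : 0 < β) (hγ : 0 < γ) (hX : 0 < X)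
    (hY : 0 < Y) :
    ∫⁻ x in Ioi (0 : ℝ), ENNReal.ofReal (x ^ (β - 1) * (X + x * Y) ^ (-(β + γ)))
      = ENNReal.ofReal (Real.Gamma β * Real.Gamma γ / Real.Gamma (β + γ)
          * (X ^ (-γ) * Y ^ (-β))) := by
  have hG : 0 < Real.Gamma (β + γ) := Real.Gamma_pos_of_pos (by positivity)
  have hGβ : 0 < Real.Gamma β := Real.Gamma_pos_of_pos hβ
  have hGγ : 0 < Real.Gamma γ := Real.Gamma_pos_of_pos hγ
  calc
    _ = ∫⁻ x in Ioi (0 : ℝ), ∫⁻ l in Ioi (0 : ℝ), ENNReal.ofReal ((Real.Gamma (β + γ))⁻¹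
          * x ^ (β - 1) * (l ^ (β + γ - 1) * Real.exp (-((X + x * Y) * l)))) := by
      refine setLIntegral_congr_fun measurableSet_Ioi fun x (hx : 0 < x) => ?_
      simp_rw [ENNReal.ofReal_mul (show 0 ≤ (Real.Gamma (β + γ))⁻¹ * x ^ (β - 1) by positivity)]
      rw [lintegral_const_mul _ (by fun_prop),
        setLIntegral_rpow_mul_exp_neg_mul (by positivity) (by positivity),
        ← ENNReal.ofReal_mul (by positivity)]
      congr 1
      field_simp
    _ = ∫⁻ l in Ioi (0 : ℝ), ∫⁻ x in Ioi (0 : ℝ), ENNReal.ofReal ((Real.Gamma (β + γ))⁻¹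
          * x ^ (β - 1) * (l ^ (β + γ - 1) * Real.exp (-((X + x * Y) * l)))) :=
      lintegral_lintegral_swap (by fun_prop)
    _ = ∫⁻ l in Ioi (0 : ℝ), ENNReal.ofReal ((Real.Gamma (β + γ))⁻¹ * Real.Gamma β * Y ^ (-β)
          * (l ^ (γ - 1) * Real.exp (-(X * l)))) := by
      refine setLIntegral_congr_fun measurableSet_Ioi fun l (hl : 0 < l) => ?_
      have : ∀ x : ℝ, (Real.Gamma (β + γ))⁻¹ * x ^ (β - 1)
          * (l ^ (β + γ - 1) * Real.exp (-((X + x * Y) * l)))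
          = ((Real.Gamma (β + γ))⁻¹ * l ^ (β + γ - 1) * Real.exp (-(X * l)))
            * (x ^ (β - 1) * Real.exp (-(Y * l * x))) := fun x => by
        rw [show -((X + x * Y) * l) = -(X * l) + -(Y * l * x) by ring, Real.exp_add]
        ring
      simp_rw [this]
      simp_rw [ENNReal.ofReal_mul (show 0 ≤ (Real.Gamma (β + γ))⁻¹ * l ^ (β + γ - 1)
        * Real.exp (-(X * l)) by positivity)]
      rw [lintegral_const_mul _ (by fun_prop),
        setLIntegral_rpow_mul_exp_neg_mul hβ (by positivity),
        ← ENNReal.ofReal_mul (by positivity)]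
      congr 1
      rw [Real.mul_rpow hY.le hl.le, show γ - 1 = (β + γ - 1) + -β by ring, Real.rpow_add hl]
      ring
    _ = _ := by
      simp_rw [ENNReal.ofReal_mul (show 0 ≤ (Real.Gamma (β + γ))⁻¹ * Real.Gamma β * Y ^ (-β) by
        positivity)]
      rw [lintegral_const_mul _ (by fun_prop), setLIntegral_rpow_mul_exp_neg_mul hγ hX,
        ← ENNReal.ofReal_mul (by positivity)]
      congr 1
      ring

/-- The map `w ↦ w - w⁻¹` sends the positive half-line bijectively to the line. -/
theorem lintegral_eq_setLIntegral_Ioi_sub_inv (f : ℝ → ℝ≥0∞) :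
    ∫⁻ x, f x = ∫⁻ w in Ioi (0 : ℝ), ENNReal.ofReal (1 + (w ^ 2)⁻¹) * f (w - w⁻¹) := by
  have hpos : ∀ y : ℝ, 0 < y + √(y ^ 2 + 4) := fun y => by
    have : |y| < √(y ^ 2 + 4) := Real.lt_sqrt_of_sq_lt (by rw [sq_abs]; linarith)
    linarith [neg_abs_le y]
  rw [← setLIntegral_univ, setLIntegral_eq_of_invOn (s := Ioi 0) (φ := fun w => w - w⁻¹)
    (φ' := fun w => 1 + (w ^ 2)⁻¹) (ψ := fun y => (y + √(y ^ 2 + 4)) / 2) measurableSet_Ioi]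
  · refine setLIntegral_congr_fun measurableSet_Ioi fun w (hw : 0 < w) => ?_
    simp only [abs_of_pos (show 0 < 1 + (w ^ 2)⁻¹ by positivity)]
  · intro w (hw : 0 < w)
    exact ((hasDerivAt_id' w).sub (hasDerivAt_inv hw.ne')).congr_deriv (by ring)
  · intro w (hw : 0 < w)
    refine ⟨mem_univ _, ?_⟩
    have : (w - w⁻¹) ^ 2 + 4 = (w + w⁻¹) ^ 2 := by field_simp; ring
    simp only [this, Real.sqrt_sq (show 0 ≤ w + w⁻¹ by positivity)]
    ring
  · intro y _
    refine ⟨mem_Ioi.2 (half_pos (hpos y)), ?_⟩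
    have h := Real.sq_sqrt (show 0 ≤ y ^ 2 + 4 by positivity)
    have := (hpos y).ne'
    field_simp
    nlinarith

/-- The integral of an even function is twice its integral over the positive half-line. -/
theorem lintegral_comp_sq (F : ℝ → ℝ≥0∞) :
    ∫⁻ x, F (x ^ 2) = 2 * ∫⁻ x in Ioi (0 : ℝ), F (x ^ 2) := by
  rw [← lintegral_add_compl _ (measurableSet_Ioi (a := (0 : ℝ))), two_mul, compl_Ioi,
    setLIntegral_congr Iio_ae_eq_Iic.symm,
    setLIntegral_eq_of_invOn (s := Ioi 0) (t := Iio 0) (φ := fun x => -x) (φ' := fun _ => -1)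
      (ψ := fun x => -x) measurableSet_Ioi]
  · simp
  · exact fun x _ => hasDerivAt_neg x
  · simp
  · simp

/-- The Cauchy–Schlömilch transformation. -/
theorem setLIntegral_Ioi_comp_sub_inv_sq {F : ℝ → ℝ≥0∞} (hF : Measurable F) :
    ∫⁻ w in Ioi (0 : ℝ), F ((w - w⁻¹) ^ 2) = ∫⁻ x in Ioi (0 : ℝ), F (x ^ 2) := by
  have hinv : ∫⁻ w in Ioi (0 : ℝ), F ((w - w⁻¹) ^ 2)
      = ∫⁻ w in Ioi (0 : ℝ), ENNReal.ofReal ((w ^ 2)⁻¹) * F ((w - w⁻¹) ^ 2) := by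
    rw [setLIntegral_Ioi_comp_mul_rpow one_pos (show (-1 : ℝ) ≠ 0 by norm_num)]
    refine setLIntegral_congr_fun measurableSet_Ioi fun w (hw : 0 < w) => ?_
    rw [show (-1 - 1 : ℝ) = -2 by norm_num, Real.rpow_neg hw.le, Real.rpow_neg_one, Real.rpow_two]
    simp only [abs_neg, abs_one, one_mul, inv_inv]
    rw [show (w⁻¹ - w) ^ 2 = (w - w⁻¹) ^ 2 by ring]
  have h := lintegral_eq_setLIntegral_Ioi_sub_inv fun x => F (x ^ 2)
  rw [lintegral_comp_sq] at h
  have hsplit : ∫⁻ w in Ioi (0 : ℝ), ENNReal.ofReal (1 + (w ^ 2)⁻¹) * F ((w - w⁻¹) ^ 2)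
      = 2 * ∫⁻ w in Ioi (0 : ℝ), F ((w - w⁻¹) ^ 2) := by
    rw [two_mul]
    nth_rewrite 2 [hinv]
    rw [← lintegral_add_left (by fun_prop)]
    refine lintegral_congr fun w => ?_
    rw [ENNReal.ofReal_add zero_le_one (by positivity), ENNReal.ofReal_one, add_mul, one_mul]
  rw [hsplit] at h
  exact ((ENNReal.mul_right_inj two_ne_zero ENNReal.ofNat_ne_top).1 h).symm

/-- Tonelli's theorem over a measurable region of a rectangle. -/
theorem setLIntegral_sep_swap {s t : Set ℝ} {P : ℝ → ℝ → Prop}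
    (hP : MeasurableSet {p : ℝ × ℝ | P p.1 p.2}) {f : ℝ → ℝ → ℝ≥0∞}
    (hf : Measurable (Function.uncurry f)) :
    ∫⁻ x in s, ∫⁻ y in {y ∈ t | P x y}, f x y = ∫⁻ y in t, ∫⁻ x in {x ∈ s | P x y}, f x y := by
  have hind : Measurable ({p : ℝ × ℝ | P p.1 p.2}.indicator (Function.uncurry f)) :=
    hf.indicator hP
  have hleft : ∀ x, ∫⁻ y in {y ∈ t | P x y}, f x y
      = ∫⁻ y in t, {p : ℝ × ℝ | P p.1 p.2}.indicator (Function.uncurry f) (x, y) := fun x => by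
    have hPx : MeasurableSet {y | P x y} := measurable_prodMk_left hP
    rw [show {y ∈ t | P x y} = {y | P x y} ∩ t from inter_comm _ _, ← Measure.restrict_restrict hPx,
      ← lintegral_indicator hPx]
    rfl
  have hright : ∀ y, ∫⁻ x in {x ∈ s | P x y}, f x y
      = ∫⁻ x in s, {p : ℝ × ℝ | P p.1 p.2}.indicator (Function.uncurry f) (x, y) := fun y => by
    have hPy : MeasurableSet {x | P x y} := measurable_prodMk_right hP
    rw [show {x ∈ s | P x y} = {x | P x y} ∩ s from inter_comm _ _, ← Measure.restrict_restrict hPy,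
      ← lintegral_indicator hPy]
    rfl
  simp_rw [hleft, hright]
  exact lintegral_lintegral_swap hind.aemeasurable

/-- The unnormalised Mellin transform of the sum of two beta prime variables, in the coordinates
`n = y / x` and `r = x + y`. -/
theorem setLIntegral_sum_betaPrime_kernel (a b s : ℝ) :
    ∫⁻ x in Ioi (0 : ℝ), ∫⁻ y in Ioi (0 : ℝ), ENNReal.ofReal ((x + y) ^ s
        * (x ^ (a - 1) * (1 + x) ^ (-(a + b))) * (y ^ (a - 1) * (1 + y) ^ (-(a + b))))
      = ∫⁻ r in Ioi (0 : ℝ), ∫⁻ n in Ioi (0 : ℝ), ENNReal.ofReal (r ^ (2 * a + s - 1)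
        * (n ^ (a - 1) * (1 + n) ^ (2 * b) * ((1 + r + n) * (1 + (1 + r) * n)) ^ (-(a + b)))) := by
  calc
    _ = ∫⁻ x in Ioi (0 : ℝ), ∫⁻ n in Ioi (0 : ℝ), ENNReal.ofReal x * ENNReal.ofReal ((x + x * n) ^ s
        * (x ^ (a - 1) * (1 + x) ^ (-(a + b)))
        * ((x * n) ^ (a - 1) * (1 + x * n) ^ (-(a + b)))) :=
      setLIntegral_congr_fun measurableSet_Ioi fun x (hx : 0 < x) =>
        setLIntegral_Ioi_comp_mul hx _
    _ = ∫⁻ n in Ioi (0 : ℝ), ∫⁻ x in Ioi (0 : ℝ), ENNReal.ofReal x * ENNReal.ofReal ((x + x * n) ^ s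
        * (x ^ (a - 1) * (1 + x) ^ (-(a + b)))
        * ((x * n) ^ (a - 1) * (1 + x * n) ^ (-(a + b)))) :=
      lintegral_lintegral_swap (by fun_prop)
    _ = ∫⁻ n in Ioi (0 : ℝ), ∫⁻ r in Ioi (0 : ℝ), ENNReal.ofReal (r ^ (2 * a + s - 1)
        * (n ^ (a - 1) * (1 + n) ^ (2 * b)
          * ((1 + r + n) * (1 + (1 + r) * n)) ^ (-(a + b)))) := by
      refine setLIntegral_congr_fun measurableSet_Ioi fun n (hn : 0 < n) => ?_
      rw [setLIntegral_Ioi_comp_mul (show 0 < (1 + n)⁻¹ by positivity)]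
      refine setLIntegral_congr_fun measurableSet_Ioi fun r (hr : 0 < r) => ?_
      rw [← ENNReal.ofReal_mul (by positivity), ← ENNReal.ofReal_mul (by positivity)]
      congr 1
      rw [show (1 + n)⁻¹ * r + (1 + n)⁻¹ * r * n = r by field_simp,
        show 1 + (1 + n)⁻¹ * r = (1 + r + n) / (1 + n) by field_simp; ring,
        show 1 + (1 + n)⁻¹ * r * n = (1 + (1 + r) * n) / (1 + n) by field_simp; ring]
      refine Real.log_injOn_pos (mem_Ioi.2 (by positivity)) (mem_Ioi.2 (by positivity)) ?_
      simp (disch := positivity) only [Real.log_mul, Real.log_div, Real.log_inv, Real.log_rpow]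
      ring
    _ = _ := lintegral_lintegral_swap (by fun_prop)

/-- The substitution `T = √(u / v)` for fixed `u`. -/
theorem setLIntegral_Ioo_eq_setLIntegral_sqrt_div {a b s u : ℝ} (hu : 0 < u) (hu1 : u < 1) :
    ∫⁻ v in Ioo (0 : ℝ) 1, ENNReal.ofReal (u ^ (a - 1) * (1 - u) ^ (-(1 / 2) : ℝ)
        * v ^ (b - 1) * (1 - v) ^ (-(1 / 2) - b) * (1 + √(u / v)) ^ s)
      = ∫⁻ T in {T ∈ Ioi (0 : ℝ) | u < T ^ 2}, ENNReal.ofReal (2 * (u ^ (a + b - 1)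
        * (1 - u) ^ (-(1 / 2) : ℝ) * (T ^ 2 - u) ^ (-(1 / 2) - b) * (1 + T) ^ s)) := by
  have hmeas : MeasurableSet {T ∈ Ioi (0 : ℝ) | u < T ^ 2} :=
    measurableSet_Ioi.inter (measurableSet_lt (f := fun _ => u) (g := fun T : ℝ => T ^ 2)
      (by fun_prop) (by fun_prop))
  rw [setLIntegral_eq_of_invOn (s := {T ∈ Ioi (0 : ℝ) | u < T ^ 2}) (φ := fun T => u / T ^ 2)
    (φ' := fun T => -(2 * u / T ^ 3)) (ψ := fun v => √(u / v)) hmeas]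
  · refine setLIntegral_congr_fun hmeas ?_
    rintro T ⟨hT : 0 < T, huT : u < T ^ 2⟩
    have h1 : 0 < 1 - u := by linarith
    have h2 : 0 < T ^ 2 - u := by linarith
    simp only [abs_neg]
    rw [abs_of_pos (by positivity), ← ENNReal.ofReal_mul (by positivity)]
    congr 1
    rw [show u / (u / T ^ 2) = T ^ 2 by field_simp, Real.sqrt_sq hT.le,
      show 1 - u / T ^ 2 = (T ^ 2 - u) / T ^ 2 by field_simp]
    refine Real.log_injOn_pos (mem_Ioi.2 (by positivity)) (mem_Ioi.2 (by positivity)) ?_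
    simp (disch := positivity) only [Real.log_mul, Real.log_div, Real.log_rpow, Real.log_pow]
    push_cast
    ring
  · rintro T ⟨hT : 0 < T, -⟩
    refine ((hasDerivAt_const T u).div (hasDerivAt_pow 2 T) (by positivity)).congr_deriv ?_
    field_simp
    norm_num
    ring
  · rintro T ⟨hT : 0 < T, huT : u < T ^ 2⟩
    refine ⟨⟨by positivity, (div_lt_one (by positivity)).2 huT⟩, ?_⟩
    rw [show u / (u / T ^ 2) = T ^ 2 by field_simp, Real.sqrt_sq hT.le]
  · rintro v ⟨hv : 0 < v, hv1 : v < 1⟩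
    have hsq : √(u / v) ^ 2 = u / v := Real.sq_sqrt (by positivity)
    refine ⟨⟨mem_Ioi.2 (by positivity), ?_⟩, ?_⟩
    · rw [hsq]
      exact (lt_div_iff₀ hv).2 (by nlinarith)
    · simp only [hsq]
      field_simp

/-- The substitution `1 - u = (1 + T) / ((1 + σ) * (1 + y))` with `y = T + σ * (T - 1)`, for fixed
`T`. -/
theorem setLIntegral_sep_lt_sq_eq {a b s T : ℝ} (hT : 0 < T) :
    ∫⁻ u in {u ∈ Ioo (0 : ℝ) 1 | u < T ^ 2}, ENNReal.ofReal (2 * (u ^ (a + b - 1)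
        * (1 - u) ^ (-(1 / 2) : ℝ) * (T ^ 2 - u) ^ (-(1 / 2) - b) * (1 + T) ^ s))
      = ∫⁻ σ in {σ ∈ Ioi (0 : ℝ) | 0 < T + σ * (T - 1)}, ENNReal.ofReal (4
        * ((T + σ * (T - 1)) ^ (-2 * b) * σ ^ (a + b - 1) * (T + (T + σ * (T - 1))) ^ (a + b - 1)
          * (1 + T) ^ (s - b) * ((1 + σ) * (1 + (T + σ * (T - 1)))) ^ (-a))) := by
  have hmeas : MeasurableSet {σ ∈ Ioi (0 : ℝ) | 0 < T + σ * (T - 1)} :=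
    measurableSet_Ioi.inter (measurableSet_lt (f := fun _ => 0)
      (g := fun σ : ℝ => T + σ * (T - 1)) (by fun_prop) (by fun_prop))
  have hone : ∀ σ y : ℝ, 0 < σ → 0 < y → T + σ * (T - 1) = y →
      (1 - (1 + T) / ((1 + σ) * (1 + y)) = σ * (T + y) / ((1 + σ) * (1 + y))
      ∧ T ^ 2 - (1 - (1 + T) / ((1 + σ) * (1 + y))) = y ^ 2 * ((1 + T) / ((1 + σ) * (1 + y)))) := by
    intro σ y hσ hy h
    constructor
    · field_simp
      subst h
      ring
    · field_simp
      subst h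
      ring
  rw [setLIntegral_eq_of_invOn (s := {σ ∈ Ioi (0 : ℝ) | 0 < T + σ * (T - 1)})
    (φ := fun σ => 1 - (1 + T) / ((1 + σ) * (1 + (T + σ * (T - 1)))))
    (φ' := fun σ => 2 * (1 + T) * (T + σ * (T - 1)) / ((1 + σ) * (1 + (T + σ * (T - 1)))) ^ 2)
    (ψ := fun u => u * (T + 1) / ((1 - u) * (√((T ^ 2 - u) / (1 - u)) + T))) hmeas]
  · refine setLIntegral_congr_fun hmeas ?_
    rintro σ ⟨hσ : 0 < σ, hy : 0 < T + σ * (T - 1)⟩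
    obtain ⟨h1, h2⟩ := hone σ _ hσ hy rfl
    beta_reduce
    rw [h2, sub_sub_cancel, h1]
    generalize T + σ * (T - 1) = y at *
    rw [abs_of_pos (by positivity), ← ENNReal.ofReal_mul (by positivity)]
    congr 1
    rw [show (4 : ℝ) = 2 * 2 by norm_num]
    refine Real.log_injOn_pos (mem_Ioi.2 (by positivity)) (mem_Ioi.2 (by positivity)) ?_
    simp (disch := positivity) only [Real.log_mul, Real.log_div, Real.log_rpow, Real.log_pow]
    push_cast
    ring
  · rintro σ ⟨hσ : 0 < σ, hy : 0 < T + σ * (T - 1)⟩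
    have hne : (1 + σ) * (1 + (T + σ * (T - 1))) ≠ 0 := by positivity
    have hlin : HasDerivAt (fun σ => (1 + σ) * (1 + (T + σ * (T - 1))))
        (1 * (1 + (T + σ * (T - 1))) + (1 + σ) * (1 * (T - 1))) σ :=
      ((hasDerivAt_id' σ).const_add 1).mul
        ((((hasDerivAt_id' σ).mul_const (T - 1)).const_add T).const_add 1)
    refine (((hasDerivAt_const σ (1 + T)).div hlin hne).const_sub 1).congr_deriv ?_
    field_simp
    ring
  · rintro σ ⟨hσ : 0 < σ, hy : 0 < T + σ * (T - 1)⟩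
    obtain ⟨h1, h2⟩ := hone σ _ hσ hy rfl
    generalize T + σ * (T - 1) = y at *
    refine ⟨⟨⟨?_, ?_⟩, ?_⟩, ?_⟩
    · rw [h1]
      positivity
    · have : 0 < (1 + T) / ((1 + σ) * (1 + y)) := by positivity
      linarith
    · have : 0 < y ^ 2 * ((1 + T) / ((1 + σ) * (1 + y))) := by positivity
      linarith
    · rw [h2, sub_sub_cancel, mul_div_cancel_right₀ _ (by positivity), Real.sqrt_sq hy.le, h1]
      field_simp
      ring
  · rintro u ⟨⟨hu : 0 < u, hu1 : u < 1⟩, huT : u < T ^ 2⟩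
    have h1 : 0 < 1 - u := by linarith
    have h2 : 0 < T ^ 2 - u := by linarith
    have hy : 0 < √((T ^ 2 - u) / (1 - u)) := by positivity
    have hsq : √((T ^ 2 - u) / (1 - u)) ^ 2 = (T ^ 2 - u) / (1 - u) := Real.sq_sqrt (by positivity)
    generalize √((T ^ 2 - u) / (1 - u)) = y at *
    rw [eq_div_iff h1.ne'] at hsq
    have hyσ : T + u * (T + 1) / ((1 - u) * (y + T)) * (T - 1) = y := by
      field_simp
      linear_combination -hsq
    refine ⟨⟨mem_Ioi.2 (by positivity), by rwa [hyσ]⟩, ?_⟩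
    simp only [hyσ]
    have hσ : u * (T + 1) / ((1 - u) * (y + T)) * ((1 - u) * (y + T)) = u * (T + 1) :=
      div_mul_cancel₀ _ (by positivity)
    have hσ0 : 0 < u * (T + 1) / ((1 - u) * (y + T)) := by positivity
    generalize u * (T + 1) / ((1 - u) * (y + T)) = σ at *
    have hprod : (1 - u) * ((1 + σ) * (1 + y)) = 1 + T := by
      linear_combination hσ - (1 - u) * hyσ
    rw [← hprod, mul_div_cancel_right₀ _ (by positivity), sub_sub_cancel]

/-- A rational parametrisation of the unnormalised Mellin transform of `1 + √(U / V)`. -/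
theorem setLIntegral_sqrt_ratio (a b s : ℝ) :
    ∫⁻ u in Ioo (0 : ℝ) 1, ∫⁻ v in Ioo (0 : ℝ) 1, ENNReal.ofReal (u ^ (a - 1)
        * (1 - u) ^ (-(1 / 2) : ℝ) * v ^ (b - 1) * (1 - v) ^ (-(1 / 2) - b) * (1 + √(u / v)) ^ s)
      = ∫⁻ σ in Ioi (0 : ℝ), ∫⁻ y in Ioi (0 : ℝ), ENNReal.ofReal (4 * (y ^ (-2 * b)
        * (1 + y) ^ (-a) * σ ^ (a + b - 1) * (2 * y + σ * (1 + y)) ^ (a + b - 1))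
        * ((1 + y + 2 * σ) ^ (-(b - s)) * (1 + σ) ^ (-(2 * a + s)))) := by
  calc
    _ = ∫⁻ u in Ioo (0 : ℝ) 1, ∫⁻ T in {T ∈ Ioi (0 : ℝ) | u < T ^ 2},
        ENNReal.ofReal (2 * (u ^ (a + b - 1)
          * (1 - u) ^ (-(1 / 2) : ℝ) * (T ^ 2 - u) ^ (-(1 / 2) - b) * (1 + T) ^ s)) :=
      setLIntegral_congr_fun measurableSet_Ioo fun u hu =>
        setLIntegral_Ioo_eq_setLIntegral_sqrt_div hu.1 hu.2
    _ = ∫⁻ T in Ioi (0 : ℝ), ∫⁻ u in {u ∈ Ioo (0 : ℝ) 1 | u < T ^ 2},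
        ENNReal.ofReal (2 * (u ^ (a + b - 1)
          * (1 - u) ^ (-(1 / 2) : ℝ) * (T ^ 2 - u) ^ (-(1 / 2) - b) * (1 + T) ^ s)) := by
      refine setLIntegral_sep_swap (P := fun u T => u < T ^ 2) (measurableSet_lt
        (f := fun p : ℝ × ℝ => p.1) (g := fun p => p.2 ^ 2) (by fun_prop) (by fun_prop)) ?_
      fun_prop
    _ = ∫⁻ T in Ioi (0 : ℝ), ∫⁻ σ in {σ ∈ Ioi (0 : ℝ) | 0 < T + σ * (T - 1)}, ENNReal.ofReal (4
        * ((T + σ * (T - 1)) ^ (-2 * b) * σ ^ (a + b - 1) * (T + (T + σ * (T - 1))) ^ (a + b - 1)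
          * (1 + T) ^ (s - b) * ((1 + σ) * (1 + (T + σ * (T - 1)))) ^ (-a))) :=
      setLIntegral_congr_fun measurableSet_Ioi fun T hT => setLIntegral_sep_lt_sq_eq hT
    _ = ∫⁻ σ in Ioi (0 : ℝ), ∫⁻ T in {T ∈ Ioi (0 : ℝ) | 0 < T + σ * (T - 1)}, ENNReal.ofReal (4
        * ((T + σ * (T - 1)) ^ (-2 * b) * σ ^ (a + b - 1) * (T + (T + σ * (T - 1))) ^ (a + b - 1)
          * (1 + T) ^ (s - b) * ((1 + σ) * (1 + (T + σ * (T - 1)))) ^ (-a))) := by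
      refine setLIntegral_sep_swap (P := fun T σ => 0 < T + σ * (T - 1)) (measurableSet_lt
        (f := fun _ => 0) (g := fun p : ℝ × ℝ => p.1 + p.2 * (p.1 - 1))
        (by fun_prop) (by fun_prop)) ?_
      fun_prop
    _ = _ := by
      refine setLIntegral_congr_fun measurableSet_Ioi fun σ (hσ : 0 < σ) => ?_
      rw [setLIntegral_eq_of_invOn (s := Ioi 0) (φ := fun y => (y + σ) / (1 + σ))
        (φ' := fun _ => 1 / (1 + σ)) (ψ := fun T => T + σ * (T - 1)) measurableSet_Ioi]
      · refine setLIntegral_congr_fun measurableSet_Ioi fun y (hy : 0 < y) => ?_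
        rw [show (y + σ) / (1 + σ) + σ * ((y + σ) / (1 + σ) - 1) = y by field_simp; ring,
          show (y + σ) / (1 + σ) + y = (2 * y + σ * (1 + y)) / (1 + σ) by field_simp; ring,
          show 1 + (y + σ) / (1 + σ) = (1 + y + 2 * σ) / (1 + σ) by field_simp; ring,
          abs_of_pos (by positivity), ← ENNReal.ofReal_mul (by positivity)]
        congr 1
        refine Real.log_injOn_pos (mem_Ioi.2 (by positivity)) (mem_Ioi.2 (by positivity)) ?_
        simp (disch := positivity) only [Real.log_mul, Real.log_div, Real.log_rpow, Real.log_one]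
        ring
      · exact fun y _ => ((hasDerivAt_id' y).add_const σ).div_const (1 + σ)
      · intro y (hy : 0 < y)
        have h : (y + σ) / (1 + σ) + σ * ((y + σ) / (1 + σ) - 1) = y := by field_simp; ring
        exact ⟨⟨mem_Ioi.2 (by positivity), by rwa [h]⟩, h⟩
      · rintro T ⟨_, hT⟩
        refine ⟨hT, ?_⟩
        field_simp
        ring

/-- The angular part of the Mellin transform of the sum of two beta prime variables, as a function
of `R = 1 + x + y`. -/
noncomputable def sumKernel (a b R : ℝ) : ℝ≥0∞ :=
  ∫⁻ n in Ioi (0 : ℝ), ENNReal.ofReal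
    (n ^ (a - 1) * (1 + n) ^ (2 * b) * ((R + n) * (1 + R * n)) ^ (-(a + b)))

/-- The counterpart of `sumKernel` for the product of a beta prime variable and `1 + √(U / V)`. -/
noncomputable def ratioKernel (a b R : ℝ) : ℝ≥0∞ :=
  ∫⁻ σ in Ioi (0 : ℝ), ∫⁻ y in Ioi (0 : ℝ), ENNReal.ofReal (y ^ (-2 * b) * (1 + y) ^ (-a)
    * σ ^ (a + b - 1) * (2 * y + σ * (1 + y)) ^ (a + b - 1)
    * (R + y + σ * (R + 1)) ^ (-(2 * a + b)))

theorem setLIntegral_ofReal_const_mul {k : ℝ} (hk : 0 ≤ k) {f : ℝ → ℝ} (hf : Measurable f)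
    (s : Set ℝ) :
    ∫⁻ x in s, ENNReal.ofReal (k * f x) = ENNReal.ofReal k * ∫⁻ x in s, ENNReal.ofReal (f x) := by
  simp_rw [ENNReal.ofReal_mul hk]
  exact lintegral_const_mul _ hf.ennreal_ofReal

theorem ratioKernel_one_sub {b R : ℝ} (hb : b < 1) (hR : 0 < R) :
    ratioKernel (1 - b) b R = ENNReal.ofReal (1 / ((1 - b) * (R + 1)))
      * ∫⁻ y in Ioi (0 : ℝ), ENNReal.ofReal
        (y ^ (-2 * b) * (1 + y) ^ (-(1 - b)) * (R + y) ^ (-(1 - b))) := by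
  have hG := Real.Gamma_pos_of_pos (sub_pos.2 hb)
  have hb' := sub_pos.2 hb
  rw [ratioKernel, lintegral_lintegral_swap (by fun_prop),
    ← setLIntegral_ofReal_const_mul (by positivity) (by fun_prop)]
  refine setLIntegral_congr_fun measurableSet_Ioi fun y (hy : 0 < y) => ?_
  calc
    _ = ∫⁻ σ in Ioi (0 : ℝ), ENNReal.ofReal ((y ^ (-2 * b) * (1 + y) ^ (-(1 - b)))
        * (σ ^ ((1 : ℝ) - 1) * (R + y + σ * (R + 1)) ^ (-(1 + (1 - b))))) := by
      refine lintegral_congr fun σ => ?_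
      simp only [show 1 - b + b - 1 = 0 by ring, sub_self, Real.rpow_zero, mul_one, one_mul]
      ring_nf
    _ = _ := by
      rw [setLIntegral_ofReal_const_mul (by positivity) (by fun_prop),
        setLIntegral_rpow_mul_add_mul_rpow one_pos hb' (by positivity) (by positivity),
        ← ENNReal.ofReal_mul (by positivity)]
      congr 1
      rw [Real.Gamma_one, add_comm 1 (1 - b), Real.Gamma_add_one hb'.ne', Real.rpow_neg_one]
      field_simp

theorem sumKernel_one_sub {b R : ℝ} (hR : 0 < R) :
    sumKernel (1 - b) b R = ENNReal.ofReal (2 / (R + 1))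
      * ∫⁻ n in Ioi (0 : ℝ), ENNReal.ofReal
        (n ^ (-b) * (1 + n) ^ (-(1 - 2 * b)) * (1 + R * n)⁻¹) := by
  have hinv : ∫⁻ n in Ioi (0 : ℝ), ENNReal.ofReal
        (n ^ (-b) * (1 + n) ^ (-(1 - 2 * b)) * (R + n)⁻¹)
      = ∫⁻ n in Ioi (0 : ℝ), ENNReal.ofReal
        (n ^ (-b) * (1 + n) ^ (-(1 - 2 * b)) * (1 + R * n)⁻¹) := by
    rw [setLIntegral_Ioi_comp_mul_rpow one_pos (show (-1 : ℝ) ≠ 0 by norm_num)]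
    refine setLIntegral_congr_fun measurableSet_Ioi fun n (hn : 0 < n) => ?_
    rw [← ENNReal.ofReal_mul (by positivity)]
    congr 1
    rw [Real.rpow_neg_one, one_mul, one_mul, show 1 + n⁻¹ = (1 + n) / n by field_simp; ring,
      show R + n⁻¹ = (1 + R * n) / n by field_simp; ring, abs_neg, abs_one, one_mul]
    refine Real.log_injOn_pos (mem_Ioi.2 (by positivity)) (mem_Ioi.2 (by positivity)) ?_
    simp (disch := positivity) only [Real.log_mul, Real.log_div, Real.log_inv, Real.log_rpow]
    ring
  calc
    _ = ∫⁻ n in Ioi (0 : ℝ), (ENNReal.ofReal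
          ((R + 1)⁻¹ * (n ^ (-b) * (1 + n) ^ (-(1 - 2 * b)) * (R + n)⁻¹))
        + ENNReal.ofReal
          ((R + 1)⁻¹ * (n ^ (-b) * (1 + n) ^ (-(1 - 2 * b)) * (1 + R * n)⁻¹))) := by
      refine setLIntegral_congr_fun measurableSet_Ioi fun n (hn : 0 < n) => ?_
      rw [← ENNReal.ofReal_add (by positivity) (by positivity)]
      congr 1
      rw [show 1 - b - 1 = -b by ring, show -(1 - b + b) = (-1 : ℝ) by ring, Real.rpow_neg_one,
        show 2 * b = 1 + -(1 - 2 * b) by ring, Real.rpow_add (by positivity), Real.rpow_one,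
        show -(1 - (1 + -(1 - 2 * b))) = -(1 - 2 * b) by ring]
      field_simp
      ring
    _ = _ := by
      rw [lintegral_add_left (by fun_prop), setLIntegral_ofReal_const_mul (by positivity)
        (by fun_prop), setLIntegral_ofReal_const_mul (by positivity) (by fun_prop), hinv,
        ← add_mul, ← ENNReal.ofReal_add (by positivity) (by positivity)]
      congr 2
      ring

theorem ratioKernel_one_sub_eq_mul_sumKernel {b R : ℝ} (hb : b < 1 / 2) (hR : 0 < R) :
    ratioKernel (1 - b) b R = ENNReal.ofReal
      (Real.Gamma (1 - 2 * b) / (2 * (1 - b) * Real.Gamma (1 - b) ^ 2))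
        * sumKernel (1 - b) b R := by
  have h1 : 0 < 1 - b := by linarith
  have h2 : 0 < 1 - 2 * b := by linarith
  have hG1 := Real.Gamma_pos_of_pos h1
  have hG2 := Real.Gamma_pos_of_pos h2
  have hG3 : 0 < Real.Gamma (1 - b + (1 - b)) := Real.Gamma_pos_of_pos (by linarith)
  have hswap : ∫⁻ y in Ioi (0 : ℝ), ENNReal.ofReal
        (y ^ (-2 * b) * (1 + y) ^ (-(1 - b)) * (R + y) ^ (-(1 - b)))
      = ENNReal.ofReal (Real.Gamma (1 - 2 * b) / Real.Gamma (1 - b) ^ 2)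
        * ∫⁻ n in Ioi (0 : ℝ), ENNReal.ofReal
          (n ^ (-b) * (1 + n) ^ (-(1 - 2 * b)) * (1 + R * n)⁻¹) := by
    set k := Real.Gamma (1 - b + (1 - b)) / Real.Gamma (1 - b) ^ 2 with hk
    calc
      _ = ∫⁻ y in Ioi (0 : ℝ), ∫⁻ n in Ioi (0 : ℝ), ENNReal.ofReal ((k * y ^ (-2 * b))
          * (n ^ (1 - b - 1) * (1 + y + n * (R + y)) ^ (-(1 - b + (1 - b))))) := by
        refine setLIntegral_congr_fun measurableSet_Ioi fun y (hy : 0 < y) => ?_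
        rw [setLIntegral_ofReal_const_mul (by positivity) (by fun_prop),
          setLIntegral_rpow_mul_add_mul_rpow h1 h1 (by positivity) (by positivity),
          ← ENNReal.ofReal_mul (by positivity), hk]
        congr 1
        field_simp
      _ = ∫⁻ n in Ioi (0 : ℝ), ∫⁻ y in Ioi (0 : ℝ), ENNReal.ofReal ((k * y ^ (-2 * b))
          * (n ^ (1 - b - 1) * (1 + y + n * (R + y)) ^ (-(1 - b + (1 - b))))) :=
        lintegral_lintegral_swap (by fun_prop)
      _ = ∫⁻ n in Ioi (0 : ℝ), ∫⁻ y in Ioi (0 : ℝ), ENNReal.ofReal ((k * n ^ (-b))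
          * (y ^ (1 - 2 * b - 1) * (1 + R * n + y * (1 + n)) ^ (-(1 - 2 * b + 1)))) := by
        refine lintegral_congr fun n => lintegral_congr fun y => ?_
        ring_nf
      _ = _ := by
        rw [← setLIntegral_ofReal_const_mul (by positivity) (by fun_prop)]
        refine setLIntegral_congr_fun measurableSet_Ioi fun n (hn : 0 < n) => ?_
        rw [setLIntegral_ofReal_const_mul (by positivity) (by fun_prop),
          setLIntegral_rpow_mul_add_mul_rpow h2 one_pos (by positivity) (by positivity),
          ← ENNReal.ofReal_mul (by positivity), hk, Real.Gamma_one, Real.rpow_neg_one,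
          show 1 - 2 * b + 1 = 1 - b + (1 - b) by ring]
        congr 1
        field_simp
  rw [ratioKernel_one_sub (by linarith) hR, sumKernel_one_sub hR, hswap, ← mul_assoc, ← mul_assoc,
    ← ENNReal.ofReal_mul (by positivity), ← ENNReal.ofReal_mul (by positivity)]
  congr 2
  field_simp

/-- A power of `κ + t` as an integral of powers of functions affine in `t ^ 2`. -/
theorem setLIntegral_add_sq_add_inv_sq_rpow {b κ t : ℝ} (hb : -1 < b) (hκ : 0 < κ) (ht : 0 < t) :
    ∫⁻ w in Ioi (0 : ℝ), ENNReal.ofReal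
        ((κ + (t ^ 2 * w ^ 2 + (w ^ 2)⁻¹) / 2) ^ (-(1 / 2 + (1 + b))))
      = ENNReal.ofReal (Real.Gamma (1 / 2) * Real.Gamma (1 + b) / Real.Gamma (1 / 2 + (1 + b))
        * (2 ^ (-(1 / 2) : ℝ) * t⁻¹ * (κ + t) ^ (-(1 + b)))) := by
  have hG1 : 0 < Real.Gamma (1 + b) := Real.Gamma_pos_of_pos (by linarith)
  have hG2 : 0 < Real.Gamma (1 / 2 + (1 + b)) := Real.Gamma_pos_of_pos (by linarith)
  have hG3 : 0 < Real.Gamma (1 / 2) := Real.Gamma_pos_of_pos (by norm_num)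
  have hst : 0 < √t := by positivity
  have hst2 : √t ^ 2 = t := Real.sq_sqrt ht.le
  calc
    _ = ∫⁻ w in Ioi (0 : ℝ), ENNReal.ofReal (√t)⁻¹
        * ENNReal.ofReal ((κ + t + (w - w⁻¹) ^ 2 * (t / 2)) ^ (-(1 / 2 + (1 + b)))) := by
      rw [setLIntegral_Ioi_comp_mul (inv_pos.2 hst)]
      refine setLIntegral_congr_fun measurableSet_Ioi fun w (hw : 0 < w) => ?_
      congr 3
      rw [mul_pow, inv_pow, hst2]
      field_simp
      ring
    _ = ENNReal.ofReal (√t)⁻¹ * ∫⁻ x in Ioi (0 : ℝ),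
        ENNReal.ofReal ((κ + t + x ^ 2 * (t / 2)) ^ (-(1 / 2 + (1 + b)))) := by
      rw [lintegral_const_mul _ (by fun_prop), setLIntegral_Ioi_comp_sub_inv_sq
        (F := fun z => ENNReal.ofReal ((κ + t + z * (t / 2)) ^ (-(1 / 2 + (1 + b))))) (by fun_prop)]
    _ = ENNReal.ofReal (√t)⁻¹ * ∫⁻ x in Ioi (0 : ℝ), ENNReal.ofReal (1 / 2
        * (x ^ ((1 / 2 : ℝ) - 1) * (κ + t + x * (t / 2)) ^ (-(1 / 2 + (1 + b))))) := by
      rw [setLIntegral_Ioi_comp_mul_rpow one_pos (show (1 / 2 : ℝ) ≠ 0 by norm_num)]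
      congr 1
      refine setLIntegral_congr_fun measurableSet_Ioi fun x (hx : 0 < x) => ?_
      rw [← ENNReal.ofReal_mul (by positivity), abs_of_pos (by norm_num), one_mul, one_mul,
        ← Real.sqrt_eq_rpow, Real.sq_sqrt hx.le, mul_assoc]
    _ = _ := by
      rw [setLIntegral_ofReal_const_mul (by norm_num) (by fun_prop),
        setLIntegral_rpow_mul_add_mul_rpow (by norm_num) (by linarith) (by positivity)
          (by positivity), ← ENNReal.ofReal_mul (by norm_num),
        ← ENNReal.ofReal_mul (by positivity)]
      congr 1
      rw [Real.sqrt_eq_rpow, one_div (2 : ℝ)]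
      rw [one_div] at hG2 hG3
      refine Real.log_injOn_pos (mem_Ioi.2 (by positivity)) (mem_Ioi.2 (by positivity)) ?_
      simp (disch := positivity) only [Real.log_mul, Real.log_div, Real.log_inv, Real.log_rpow]
      ring

theorem setLIntegral_rpow_mul_one_add_rpow_mul_add_rpow {b κ : ℝ} (hb : -(1 / 2) < b) (hκ : 0 < κ) :
    ∫⁻ n in Ioi (0 : ℝ), ENNReal.ofReal
        (n ^ (b - 1 / 2) * (1 + n) ^ (b - 1 / 2) * ((κ + 1) / 2 + n) ^ (-(1 + b)))
      = ENNReal.ofReal (2 * Real.Gamma (b + 1 / 2) / (Real.Gamma (1 / 2) * Real.Gamma (1 + b)))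
        * ∫⁻ m in Ioi (0 : ℝ), ENNReal.ofReal (m ^ b * (1 + 2 * κ * m + m ^ 2)⁻¹) := by
  have hG1 : 0 < Real.Gamma (1 + b) := Real.Gamma_pos_of_pos (by linarith)
  have hG2 : 0 < Real.Gamma (1 / 2 + (1 + b)) := Real.Gamma_pos_of_pos (by linarith)
  have hG3 : 0 < Real.Gamma (1 / 2) := Real.Gamma_pos_of_pos (by norm_num)
  have hG4 : 0 < Real.Gamma (b + 1 / 2) := Real.Gamma_pos_of_pos (by linarith)
  set k := 2 ^ (3 / 2 + b) * Real.Gamma (1 / 2 + (1 + b))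
    / (Real.Gamma (1 / 2) * Real.Gamma (1 + b)) with hk
  calc
    _ = ∫⁻ n in Ioi (0 : ℝ), ∫⁻ w in Ioi (0 : ℝ), ENNReal.ofReal
        ((k * (n * (1 + n)) ^ (b - 1 / 2) * (1 + 2 * n))
          * (κ + ((1 + 2 * n) ^ 2 * w ^ 2 + (w ^ 2)⁻¹) / 2) ^ (-(1 / 2 + (1 + b)))) := by
      refine setLIntegral_congr_fun measurableSet_Ioi fun n (hn : 0 < n) => ?_
      rw [setLIntegral_ofReal_const_mul (by positivity) (by fun_prop),
        setLIntegral_add_sq_add_inv_sq_rpow (by linarith) hκ (by positivity),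
        ← ENNReal.ofReal_mul (by positivity), hk]
      congr 1
      rw [show (κ + 1) / 2 + n = (κ + (1 + 2 * n)) / 2 by ring]
      refine Real.log_injOn_pos (mem_Ioi.2 (by positivity)) (mem_Ioi.2 (by positivity)) ?_
      simp (disch := positivity) only [Real.log_mul, Real.log_div, Real.log_inv, Real.log_rpow]
      ring
    _ = ∫⁻ w in Ioi (0 : ℝ), ∫⁻ n in Ioi (0 : ℝ), ENNReal.ofReal
        ((k * (n * (1 + n)) ^ (b - 1 / 2) * (1 + 2 * n))
          * (κ + ((1 + 2 * n) ^ 2 * w ^ 2 + (w ^ 2)⁻¹) / 2) ^ (-(1 / 2 + (1 + b)))) :=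
      lintegral_lintegral_swap (by fun_prop)
    _ = ∫⁻ w in Ioi (0 : ℝ), ∫⁻ z in Ioi (0 : ℝ), ENNReal.ofReal (k * (z ^ (b + 1 / 2 - 1)
        * (κ + (w ^ 2 + (w ^ 2)⁻¹) / 2 + z * (2 * w ^ 2)) ^ (-(b + 1 / 2 + 1)))) := by
      refine lintegral_congr fun w => ?_
      symm
      rw [setLIntegral_eq_of_invOn (s := Ioi 0) (t := Ioi 0) (φ := fun n => n * (1 + n))
        (φ' := fun n => 1 + 2 * n) (ψ := fun z => (√(1 + 4 * z) - 1) / 2) measurableSet_Ioi]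
      · refine setLIntegral_congr_fun measurableSet_Ioi fun n (hn : 0 < n) => ?_
        rw [abs_of_pos (by positivity), ← ENNReal.ofReal_mul (by positivity)]
        congr 1
        rw [show b + 1 / 2 - 1 = b - 1 / 2 by ring, show b + 1 / 2 + 1 = 1 / 2 + (1 + b) by ring,
          show κ + (w ^ 2 + (w ^ 2)⁻¹) / 2 + n * (1 + n) * (2 * w ^ 2)
            = κ + ((1 + 2 * n) ^ 2 * w ^ 2 + (w ^ 2)⁻¹) / 2 by ring]
        ring
      · exact fun n _ => ((hasDerivAt_id' n).mul ((hasDerivAt_id' n).const_add 1)).congr_deriv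
          (by ring)
      · intro n (hn : 0 < n)
        refine ⟨mem_Ioi.2 (by positivity), ?_⟩
        rw [show 1 + 4 * (n * (1 + n)) = (1 + 2 * n) ^ 2 by ring, Real.sqrt_sq (by positivity)]
        ring
      · intro z (hz : 0 < z)
        have hsq := Real.sq_sqrt (show 0 ≤ 1 + 4 * z by positivity)
        have : 1 < √(1 + 4 * z) := Real.lt_sqrt_of_sq_lt (by linarith)
        refine ⟨mem_Ioi.2 (by linarith), ?_⟩
        linear_combination hsq / 4
    _ = ∫⁻ w in Ioi (0 : ℝ), ENNReal.ofReal (k * (Real.Gamma (b + 1 / 2) * Real.Gamma 1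
        / Real.Gamma (b + 1 / 2 + 1) * ((κ + (w ^ 2 + (w ^ 2)⁻¹) / 2) ^ (-1 : ℝ)
          * (2 * w ^ 2) ^ (-(b + 1 / 2))))) := by
      refine setLIntegral_congr_fun measurableSet_Ioi fun w (hw : 0 < w) => ?_
      rw [setLIntegral_ofReal_const_mul (by positivity) (by fun_prop),
        setLIntegral_rpow_mul_add_mul_rpow (by linarith) one_pos (by positivity) (by positivity),
        ← ENNReal.ofReal_mul (by positivity)]
    _ = _ := by
      rw [setLIntegral_Ioi_comp_mul_rpow one_pos (show (-(1 / 2) : ℝ) ≠ 0 by norm_num),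
        ← setLIntegral_ofReal_const_mul (by positivity) (by fun_prop)]
      refine setLIntegral_congr_fun measurableSet_Ioi fun m (hm : 0 < m) => ?_
      rw [← ENNReal.ofReal_mul (by positivity)]
      congr 1
      rw [one_mul, one_mul, abs_neg, abs_of_pos (by norm_num),
        show (m ^ (-(1 / 2) : ℝ)) ^ 2 = m⁻¹ by
          rw [← Real.rpow_natCast, ← Real.rpow_mul hm.le, ← Real.rpow_neg_one]; norm_num,
        show κ + (m⁻¹ + m⁻¹⁻¹) / 2 = (1 + 2 * κ * m + m ^ 2) / (2 * m) by field_simp; ring, hk,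
        Real.Gamma_one, show b + 1 / 2 + 1 = 1 / 2 + (1 + b) by ring, mul_one, one_div (2 : ℝ)]
      rw [one_div] at hG2 hG3 hG4
      refine Real.log_injOn_pos (mem_Ioi.2 (by positivity)) (mem_Ioi.2 (by positivity)) ?_
      simp (disch := positivity) only [Real.log_mul, Real.log_div, Real.log_inv, Real.log_rpow]
      ring

theorem sumKernel_one_half {b R : ℝ} (hR : 0 < R) :
    sumKernel (1 / 2) b R = 4 * ∫⁻ x in Ioi (0 : ℝ), ENNReal.ofReal
      ((x ^ 2 + 4) ^ (b - 1 / 2) * ((R + 1) ^ 2 + R * x ^ 2) ^ (-(b + 1 / 2))) := by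
  rw [show (4 : ℝ≥0∞) = 2 * 2 by norm_num, mul_assoc,
    ← lintegral_comp_sq fun z => ENNReal.ofReal
      ((z + 4) ^ (b - 1 / 2) * ((R + 1) ^ 2 + R * z) ^ (-(b + 1 / 2))),
    lintegral_eq_setLIntegral_Ioi_sub_inv, ← lintegral_const_mul _ (by fun_prop), sumKernel,
    setLIntegral_Ioi_comp_mul_rpow one_pos two_ne_zero]
  refine setLIntegral_congr_fun measurableSet_Ioi fun w (hw : 0 < w) => ?_
  rw [← ENNReal.ofReal_mul (by positivity), ← ENNReal.ofReal_mul (by positivity),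
    ← ENNReal.ofReal_ofNat, ← ENNReal.ofReal_mul (by norm_num)]
  congr 1
  rw [Real.rpow_two, one_mul, one_mul, abs_of_pos (by norm_num),
    show (R + w ^ 2) * (1 + R * w ^ 2) = w ^ 2 * ((R + 1) ^ 2 + R * (w - w⁻¹) ^ 2) by
      field_simp; ring,
    show (w - w⁻¹) ^ 2 + 4 = ((1 + w ^ 2) / w) ^ 2 by field_simp; ring,
    show 1 + (w ^ 2)⁻¹ = (1 + w ^ 2) / w ^ 2 by field_simp; ring]
  refine Real.log_injOn_pos (mem_Ioi.2 (by positivity)) (mem_Ioi.2 (by positivity)) ?_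
  simp (disch := positivity) only [Real.log_mul, Real.log_div, Real.log_rpow, Real.log_pow]
  push_cast
  ring

theorem setLIntegral_inv_quadratic_rpow {b R : ℝ} (hb : -(1 / 2) < b) (hb' : b < 1 / 2)
    (hR : 0 < R) :
    ∫⁻ y in Ioi (0 : ℝ), ∫⁻ m in Ioi (0 : ℝ), ENNReal.ofReal
        (y ^ (-(1 + b)) * (m ^ b * (1 + 2 * ((y + R / y) / (R + 1)) * m + m ^ 2)⁻¹))
      = ENNReal.ofReal ((2 * (R + 1)) ^ (1 / 2 : ℝ) * (Real.Gamma (b + 1 / 2)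
          * Real.Gamma (1 / 2 - b)) * (2 / (R + 1)) ^ (-(b + 1 / 2)))
        * ∫⁻ x in Ioi (0 : ℝ), ENNReal.ofReal
          ((x ^ 2 + 4) ^ (b - 1 / 2) * ((R + 1) ^ 2 + R * x ^ 2) ^ (-(b + 1 / 2))) := by
  have hG1 : 0 < Real.Gamma (b + 1 / 2) := Real.Gamma_pos_of_pos (by linarith)
  have hG2 : 0 < Real.Gamma (1 / 2 - b) := Real.Gamma_pos_of_pos (by linarith)
  calc
    _ = ∫⁻ y in Ioi (0 : ℝ), ∫⁻ p in Ioi (0 : ℝ), ENNReal.ofReal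
        (p ^ b * (1 + 2 * (y ^ 2 + R) / (R + 1) * p + p ^ 2 * y ^ 2)⁻¹) := by
      refine setLIntegral_congr_fun measurableSet_Ioi fun y (hy : 0 < y) => ?_
      rw [setLIntegral_Ioi_comp_mul hy]
      refine setLIntegral_congr_fun measurableSet_Ioi fun p (hp : 0 < p) => ?_
      rw [← ENNReal.ofReal_mul (by positivity)]
      congr 1
      rw [show 1 + 2 * ((y + R / y) / (R + 1)) * (y * p) + (y * p) ^ 2
        = 1 + 2 * (y ^ 2 + R) / (R + 1) * p + p ^ 2 * y ^ 2 by field_simp]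
      refine Real.log_injOn_pos (mem_Ioi.2 (by positivity)) (mem_Ioi.2 (by positivity)) ?_
      simp (disch := positivity) only [Real.log_mul, Real.log_inv, Real.log_rpow]
      ring
    _ = ∫⁻ p in Ioi (0 : ℝ), ∫⁻ y in Ioi (0 : ℝ), ENNReal.ofReal
        (p ^ b * (1 + 2 * (y ^ 2 + R) / (R + 1) * p + p ^ 2 * y ^ 2)⁻¹) :=
      lintegral_lintegral_swap (by fun_prop)
    _ = ∫⁻ p in Ioi (0 : ℝ), ∫⁻ x in Ioi (0 : ℝ), ENNReal.ofReal ((2 * (R + 1)) ^ (1 / 2 : ℝ)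
        * (p ^ (b + 1 / 2 - 1) * (x ^ 2 + 4 + p * (2 / (R + 1) * ((R + 1) ^ 2 + R * x ^ 2)))
          ^ (-(b + 1 / 2 + (1 / 2 - b))))) := by
      refine setLIntegral_congr_fun measurableSet_Ioi fun p (hp : 0 < p) => ?_
      rw [setLIntegral_Ioi_comp_mul_rpow (show 0 < (2 * (R + 1) / p) ^ (1 / 2 : ℝ) by positivity)
        (show (-1 : ℝ) ≠ 0 by norm_num)]
      refine setLIntegral_congr_fun measurableSet_Ioi fun x (hx : 0 < x) => ?_
      rw [← ENNReal.ofReal_mul (by positivity)]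
      congr 1
      rw [Real.rpow_neg_one, mul_pow, ← Real.sqrt_eq_rpow (2 * (R + 1) / p),
        Real.sq_sqrt (by positivity), abs_neg, abs_one, mul_one, Real.sqrt_eq_rpow,
        show 1 + 2 * (2 * (R + 1) / p * x⁻¹ ^ 2 + R) / (R + 1) * p
            + p ^ 2 * (2 * (R + 1) / p * x⁻¹ ^ 2)
          = (x ^ 2 + 4 + p * (2 / (R + 1) * ((R + 1) ^ 2 + R * x ^ 2))) / x ^ 2 by
          field_simp
          ring]
      refine Real.log_injOn_pos (mem_Ioi.2 (by positivity)) (mem_Ioi.2 (by positivity)) ?_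
      simp (disch := positivity) only [Real.log_mul, Real.log_div, Real.log_inv, Real.log_rpow,
        Real.log_pow]
      push_cast
      ring
    _ = ∫⁻ x in Ioi (0 : ℝ), ∫⁻ p in Ioi (0 : ℝ), ENNReal.ofReal ((2 * (R + 1)) ^ (1 / 2 : ℝ)
        * (p ^ (b + 1 / 2 - 1) * (x ^ 2 + 4 + p * (2 / (R + 1) * ((R + 1) ^ 2 + R * x ^ 2)))
          ^ (-(b + 1 / 2 + (1 / 2 - b))))) :=
      lintegral_lintegral_swap (by fun_prop)
    _ = _ := by
      rw [← setLIntegral_ofReal_const_mul (by positivity) (by fun_prop)]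
      refine setLIntegral_congr_fun measurableSet_Ioi fun x (hx : 0 < x) => ?_
      rw [setLIntegral_ofReal_const_mul (by positivity) (by fun_prop),
        setLIntegral_rpow_mul_add_mul_rpow (by linarith) (by linarith) (by positivity)
          (by positivity), ← ENNReal.ofReal_mul (by positivity)]
      congr 1
      rw [show b + 1 / 2 + (1 / 2 - b) = 1 by ring, Real.Gamma_one, div_one, neg_sub,
        Real.mul_rpow (x := 2 / (R + 1)) (by positivity) (by positivity)]
      ring

theorem ratioKernel_one_half_eq_mul_sumKernel {b R : ℝ} (hb : -(1 / 2) < b) (hb' : b < 1 / 2)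
    (hR : 0 < R) :
    ratioKernel (1 / 2) b R = ENNReal.ofReal (Real.Gamma (b + 1 / 2) ^ 2 * Real.Gamma (1 / 2 - b)
      / (4 * (Real.Gamma (1 / 2) * Real.Gamma (1 + b)))) * sumKernel (1 / 2) b R := by
  have hG1 : 0 < Real.Gamma (b + 1 / 2) := Real.Gamma_pos_of_pos (by linarith)
  have hG2 : 0 < Real.Gamma (1 / 2 - b) := Real.Gamma_pos_of_pos (by linarith)
  have hG3 : 0 < Real.Gamma (1 / 2) := Real.Gamma_pos_of_pos (by norm_num)
  have hG4 : 0 < Real.Gamma (1 + b) := Real.Gamma_pos_of_pos (by linarith)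
  set c := 2 * Real.Gamma (b + 1 / 2) / (Real.Gamma (1 / 2) * Real.Gamma (1 + b)) with hc
  have hinner : ∀ y : ℝ, 0 < y → ∫⁻ σ in Ioi (0 : ℝ), ENNReal.ofReal (y ^ (-2 * b)
        * (1 + y) ^ (-(1 / 2) : ℝ) * σ ^ (1 / 2 + b - 1) * (2 * y + σ * (1 + y)) ^ (1 / 2 + b - 1)
        * (R + y + σ * (R + 1)) ^ (-(2 * (1 / 2) + b)))
      = ENNReal.ofReal (2 ^ (b - 1) * (R + 1) ^ (-(1 + b)) * c)
        * ∫⁻ m in Ioi (0 : ℝ), ENNReal.ofReal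
          (y ^ (-(1 + b)) * (m ^ b * (1 + 2 * ((y + R / y) / (R + 1)) * m + m ^ 2)⁻¹)) := by
    intro y hy
    calc
      _ = ∫⁻ n in Ioi (0 : ℝ), ENNReal.ofReal ((2 ^ (b - 1) * (R + 1) ^ (-(1 + b)) * y ^ (-(1 + b)))
          * (n ^ (b - 1 / 2) * (1 + n) ^ (b - 1 / 2)
            * (((y + R / y) / (R + 1) + 1) / 2 + n) ^ (-(1 + b)))) := by
        rw [setLIntegral_Ioi_comp_mul (show 0 < 2 * y / (1 + y) by positivity)]
        refine setLIntegral_congr_fun measurableSet_Ioi fun n (hn : 0 < n) => ?_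
        rw [← ENNReal.ofReal_mul (by positivity)]
        congr 1
        rw [show 2 * y + 2 * y / (1 + y) * n * (1 + y) = 2 * y * (1 + n) by field_simp,
          show R + y + 2 * y / (1 + y) * n * (R + 1)
            = 2 * y * (R + 1) / (1 + y) * (((y + R / y) / (R + 1) + 1) / 2 + n) by
            field_simp; ring]
        refine Real.log_injOn_pos (mem_Ioi.2 (by positivity)) (mem_Ioi.2 (by positivity)) ?_
        simp (disch := positivity) only [Real.log_mul, Real.log_div, Real.log_rpow]
        ring
      _ = _ := by
        rw [setLIntegral_ofReal_const_mul (by positivity) (by fun_prop),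
          setLIntegral_rpow_mul_one_add_rpow_mul_add_rpow hb (by positivity), ← hc,
          setLIntegral_ofReal_const_mul (by positivity) (by fun_prop), ← mul_assoc, ← mul_assoc,
          ← ENNReal.ofReal_mul (by positivity), ← ENNReal.ofReal_mul (by positivity)]
        congr 2
        ring
  rw [ratioKernel, lintegral_lintegral_swap (by fun_prop),
    setLIntegral_congr_fun measurableSet_Ioi hinner,
    lintegral_const_mul _ (Measurable.lintegral_prod_right (by fun_prop)),
    setLIntegral_inv_quadratic_rpow hb hb' hR, sumKernel_one_half hR, ← mul_assoc, ← mul_assoc,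
    ← mul_assoc,    ← ENNReal.ofReal_mul (by positivity), ← ENNReal.ofReal_ofNat,
    ← ENNReal.ofReal_mul (by positivity), hc]
  congr 2
  rw [show (4 : ℝ) = 2 * 2 by norm_num, one_div (2 : ℝ)]
  rw [one_div] at hG1 hG2 hG3
  refine Real.log_injOn_pos (mem_Ioi.2 (by positivity)) (mem_Ioi.2 (by positivity)) ?_
  simp (disch := positivity) only [Real.log_mul, Real.log_div, Real.log_rpow, Real.log_pow]
  push_cast
  ring

/-- For `a = 1 - b` or `a = 1 / 2`, the two kernels are proportional. -/
theorem ratioKernel_eq_mul_sumKernel {a b R : ℝ} (hb0 : 0 < b) (hb : b < 1 / 2)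
    (hab : a = 1 - b ∨ a = 1 / 2) (hR : 0 < R) :
    ratioKernel a b R = ENNReal.ofReal (Real.Gamma (a + b) ^ 2 * Real.Gamma (2 * a)
      * Real.Gamma (1 / 2 - b) / (4 * (Real.Gamma a * Real.Gamma (2 * a + b)
        * Real.Gamma (a + 1 / 2)))) * sumKernel a b R := by
  rcases hab with rfl | rfl
  · have h1 : 0 < 1 - b := by linarith
    have h2 : 0 < 1 - 2 * b := by linarith
    have h3 : 0 < 1 / 2 - b := by linarith
    have hG1 := Real.Gamma_pos_of_pos h1
    have hG2 := Real.Gamma_pos_of_pos h3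
    rw [ratioKernel_one_sub_eq_mul_sumKernel hb hR]
    congr 2
    rw [sub_add_cancel, show 2 * (1 - b) = 1 - 2 * b + 1 by ring,
      show 1 - 2 * b + 1 + b = 1 - b + 1 by ring,
      show 1 - b + 1 / 2 = 1 / 2 - b + 1 by ring, Real.Gamma_add_one h1.ne',
      Real.Gamma_add_one h2.ne', Real.Gamma_add_one h3.ne', Real.Gamma_one]
    field_simp
    ring
  · rw [ratioKernel_one_half_eq_mul_sumKernel (by linarith) hb hR]
    congr 2
    rw [show 2 * (1 / 2 : ℝ) = 1 by norm_num, show (1 / 2 + 1 / 2 : ℝ) = 1 by norm_num,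
      Real.Gamma_one, add_comm (1 / 2) b]
    ring

theorem setLIntegral_sum_eq_setLIntegral_sumKernel (a b s : ℝ) :
    ∫⁻ x in Ioi (0 : ℝ), ∫⁻ y in Ioi (0 : ℝ), ENNReal.ofReal ((x + y) ^ s
        * (x ^ (a - 1) * (1 + x) ^ (-(a + b))) * (y ^ (a - 1) * (1 + y) ^ (-(a + b))))
      = ∫⁻ r in Ioi (0 : ℝ), ENNReal.ofReal (r ^ (2 * a + s - 1)) * sumKernel a b (1 + r) := by
  rw [setLIntegral_sum_betaPrime_kernel]
  refine setLIntegral_congr_fun measurableSet_Ioi fun r (hr : 0 < r) => ?_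
  exact setLIntegral_ofReal_const_mul (by positivity) (by fun_prop) _

theorem setLIntegral_sqrt_ratio_eq_setLIntegral_ratioKernel {a b s : ℝ} (hs1 : -2 * a < s)
    (hs2 : s < b) :
    ENNReal.ofReal (Real.Gamma (2 * a + s) * Real.Gamma (b - s) / Real.Gamma (2 * a + b))
      * ∫⁻ u in Ioo (0 : ℝ) 1, ∫⁻ v in Ioo (0 : ℝ) 1, ENNReal.ofReal (u ^ (a - 1)
        * (1 - u) ^ (-(1 / 2) : ℝ) * v ^ (b - 1) * (1 - v) ^ (-(1 / 2) - b) * (1 + √(u / v)) ^ s)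
      = ENNReal.ofReal 4
        * ∫⁻ r in Ioi (0 : ℝ), ENNReal.ofReal (r ^ (2 * a + s - 1)) * ratioKernel a b (1 + r) := by
  have h1 : 0 < 2 * a + s := by linarith
  have h2 : 0 < b - s := by linarith
  have hG1 := Real.Gamma_pos_of_pos h1
  have hG2 := Real.Gamma_pos_of_pos h2
  have hG3 : 0 < Real.Gamma (2 * a + b) := Real.Gamma_pos_of_pos (by linarith)
  set F : ℝ → ℝ → ℝ → ℝ := fun r σ y => 4 * r ^ (2 * a + s - 1) * (y ^ (-2 * b) * (1 + y) ^ (-a)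
    * σ ^ (a + b - 1) * (2 * y + σ * (1 + y)) ^ (a + b - 1)
    * (1 + r + y + σ * (1 + r + 1)) ^ (-(2 * a + b))) with hF
  calc
    _ = ∫⁻ σ in Ioi (0 : ℝ), ∫⁻ y in Ioi (0 : ℝ), ∫⁻ r in Ioi (0 : ℝ),
        ENNReal.ofReal (F r σ y) := by
      rw [setLIntegral_sqrt_ratio,
        ← lintegral_const_mul _ (Measurable.lintegral_prod_right (by fun_prop))]
      refine setLIntegral_congr_fun measurableSet_Ioi fun σ (hσ : 0 < σ) => ?_
      rw [← setLIntegral_ofReal_const_mul (by positivity) (by fun_prop)]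
      refine setLIntegral_congr_fun measurableSet_Ioi fun y (hy : 0 < y) => ?_
      have hsplit : ∀ r, F r σ y = (4 * (y ^ (-2 * b) * (1 + y) ^ (-a) * σ ^ (a + b - 1)
          * (2 * y + σ * (1 + y)) ^ (a + b - 1))) * (r ^ (2 * a + s - 1)
            * (1 + y + 2 * σ + r * (1 + σ)) ^ (-(2 * a + s + (b - s)))) := fun r => by
        rw [hF, show 1 + y + 2 * σ + r * (1 + σ) = 1 + r + y + σ * (1 + r + 1) by ring,
          show 2 * a + s + (b - s) = 2 * a + b by ring]
        ring
      simp_rw [hsplit]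
      rw [setLIntegral_ofReal_const_mul (by positivity) (by fun_prop),
        setLIntegral_rpow_mul_add_mul_rpow h1 h2 (by positivity) (by positivity),
        ← ENNReal.ofReal_mul (by positivity), show 2 * a + s + (b - s) = 2 * a + b by ring]
      congr 1
      ring
    _ = ∫⁻ σ in Ioi (0 : ℝ), ∫⁻ r in Ioi (0 : ℝ), ∫⁻ y in Ioi (0 : ℝ),
        ENNReal.ofReal (F r σ y) :=
      lintegral_congr fun σ => lintegral_lintegral_swap (by fun_prop)
    _ = ∫⁻ r in Ioi (0 : ℝ), ∫⁻ σ in Ioi (0 : ℝ), ∫⁻ y in Ioi (0 : ℝ),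
        ENNReal.ofReal (F r σ y) :=
      lintegral_lintegral_swap (Measurable.lintegral_prod_right'
        (f := fun p : (ℝ × ℝ) × ℝ => ENNReal.ofReal (F p.1.2 p.1.1 p.2))
        (by fun_prop)).aemeasurable
    _ = ∫⁻ r in Ioi (0 : ℝ), ENNReal.ofReal 4
        * (ENNReal.ofReal (r ^ (2 * a + s - 1)) * ratioKernel a b (1 + r)) := by
      refine setLIntegral_congr_fun measurableSet_Ioi fun r (hr : 0 < r) => ?_
      rw [ratioKernel, ← mul_assoc, ← ENNReal.ofReal_mul (by norm_num),
        ← lintegral_const_mul _ (Measurable.lintegral_prod_right (by fun_prop))]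
      exact lintegral_congr fun σ => setLIntegral_ofReal_const_mul (by positivity) (by fun_prop) _
    _ = _ := lintegral_const_mul' _ _ ENNReal.ofReal_ne_top

theorem setLIntegral_rpow_mul_one_add_rpow_ne_top {a b p : ℝ} (hp1 : -a < p) (hp2 : p < b) :
    ∫⁻ x in Ioi (0 : ℝ), ENNReal.ofReal (x ^ p * (x ^ (a - 1) * (1 + x) ^ (-(a + b)))) ≠ ⊤ := by
  have h := setLIntegral_rpow_mul_add_mul_rpow (show 0 < a + p by linarith)
    (show 0 < b - p by linarith) one_pos one_pos
  rw [setLIntegral_congr_fun (g := fun x => ENNReal.ofReal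
    (x ^ (a + p - 1) * (1 + x * 1) ^ (-(a + p + (b - p))))) measurableSet_Ioi, h]
  · exact ENNReal.ofReal_ne_top
  · intro x (hx : 0 < x)
    beta_reduce
    rw [← mul_assoc, ← Real.rpow_add hx]
    ring_nf

theorem setLIntegral_sum_ne_top {a b s : ℝ} (ha : 0 < a) (hb0 : 0 < b) (hb : b < 1)
    (hs1 : -2 * a < s) (hs2 : s < b) :
    ∫⁻ x in Ioi (0 : ℝ), ∫⁻ y in Ioi (0 : ℝ), ENNReal.ofReal ((x + y) ^ s
        * (x ^ (a - 1) * (1 + x) ^ (-(a + b))) * (y ^ (a - 1) * (1 + y) ^ (-(a + b)))) ≠ ⊤ := by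
  set g : ℝ → ℝ → ℝ := fun p x => x ^ p * (x ^ (a - 1) * (1 + x) ^ (-(a + b))) with hg
  have hmeas : ∀ p, Measurable fun x => ENNReal.ofReal (g p x) := fun p => by fun_prop
  have hpos : ∀ p x, 0 < x → 0 ≤ g p x := fun p x hx => by positivity
  have hprod : ∀ p q, -a < p → p < b → -a < q → q < b →
      ∫⁻ x in Ioi (0 : ℝ), ∫⁻ y in Ioi (0 : ℝ),
        ENNReal.ofReal (g p x) * ENNReal.ofReal (g q y) ≠ ⊤ := by
    intro p q hp1 hp2 hq1 hq2
    rw [lintegral_lintegral_mul (hmeas p).aemeasurable (hmeas q).aemeasurable]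
    exact ENNReal.mul_ne_top (setLIntegral_rpow_mul_one_add_rpow_ne_top hp1 hp2)
      (setLIntegral_rpow_mul_one_add_rpow_ne_top hq1 hq2)
  rcases lt_or_ge s 0 with hs | hs
  · refine ne_top_of_le_ne_top (hprod (s / 2) (s / 2) (by linarith) (by linarith) (by linarith)
      (by linarith)) ?_
    refine setLIntegral_mono' measurableSet_Ioi fun x (hx : 0 < x) =>
      setLIntegral_mono' measurableSet_Ioi fun y (hy : 0 < y) => ?_
    rw [← ENNReal.ofReal_mul (hpos _ _ hx)]
    refine ENNReal.ofReal_le_ofReal ?_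
    have h1 : (x + y) ^ (s / 2) ≤ x ^ (s / 2) :=
      Real.rpow_le_rpow_of_nonpos hx (by linarith) (by linarith)
    have h2 : (x + y) ^ (s / 2) ≤ y ^ (s / 2) :=
      Real.rpow_le_rpow_of_nonpos hy (by linarith) (by linarith)
    calc
      _ = (x + y) ^ (s / 2) * (x + y) ^ (s / 2) * (x ^ (a - 1) * (1 + x) ^ (-(a + b)))
          * (y ^ (a - 1) * (1 + y) ^ (-(a + b))) := by
        rw [← Real.rpow_add (by positivity), add_halves]
      _ ≤ x ^ (s / 2) * y ^ (s / 2) * (x ^ (a - 1) * (1 + x) ^ (-(a + b)))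
          * (y ^ (a - 1) * (1 + y) ^ (-(a + b))) := by gcongr
      _ = g (s / 2) x * g (s / 2) y := by
        rw [hg]
        ring
  · refine ne_top_of_le_ne_top (ENNReal.add_ne_top.2
      ⟨hprod s 0 (by linarith) hs2 (by linarith) hb0,
        hprod 0 s (by linarith) hb0 (by linarith) hs2⟩) ?_
    rw [← lintegral_add_left (Measurable.lintegral_prod_right (by fun_prop))]
    refine setLIntegral_mono' measurableSet_Ioi fun x (hx : 0 < x) => ?_
    rw [← lintegral_add_left (by fun_prop)]
    refine setLIntegral_mono' measurableSet_Ioi fun y (hy : 0 < y) => ?_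
    rw [← ENNReal.ofReal_mul (hpos _ _ hx), ← ENNReal.ofReal_mul (hpos _ _ hx),
      ← ENNReal.ofReal_add (mul_nonneg (hpos _ _ hx) (hpos _ _ hy))
        (mul_nonneg (hpos _ _ hx) (hpos _ _ hy))]
    refine ENNReal.ofReal_le_ofReal ?_
    calc
      _ ≤ (x ^ s + y ^ s) * (x ^ (a - 1) * (1 + x) ^ (-(a + b)))
          * (y ^ (a - 1) * (1 + y) ^ (-(a + b))) := by
        gcongr
        exact Real.rpow_add_le_add_rpow hx.le hy.le hs (by linarith)
      _ = g s x * g 0 y + g 0 x * g s y := by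
        simp only [hg, Real.rpow_zero]
        ring

/-- An iterated Bochner integral of a nonnegative function with finite iterated Lebesgue
integral. -/
theorem setIntegral_setIntegral_eq_toReal {s t : Set ℝ} (hs : MeasurableSet s)
    (ht : MeasurableSet t) {f : ℝ → ℝ → ℝ} (hf : Measurable (Function.uncurry f))
    (hnonneg : ∀ x ∈ s, ∀ y ∈ t, 0 ≤ f x y)
    (hfin : ∫⁻ x in s, ∫⁻ y in t, ENNReal.ofReal (f x y) ≠ ⊤) :
    ∫ x in s, ∫ y in t, f x y = (∫⁻ x in s, ∫⁻ y in t, ENNReal.ofReal (f x y)).toReal := by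
  have hmeas : Measurable fun x => ∫⁻ y in t, ENNReal.ofReal (f x y) :=
    Measurable.lintegral_prod_right hf.ennreal_ofReal
  rw [← integral_toReal hmeas.aemeasurable (ae_lt_top hmeas hfin)]
  refine setIntegral_congr_fun hs fun x hx => ?_
  exact integral_eq_lintegral_of_nonneg_ae (ae_restrict_of_forall_mem ht (hnonneg x hx))
    hf.of_uncurry_left.aestronglyMeasurable

/-- Mellin-transform form of Theorem B:
`B'_{a,b} + B'_{a,b} = B'_{2a,b} × (1 + √(B_{a,1/2}/B_{b,1/2−b}))` in law,
for `b ∈ (0,1/2)` and `a = 1 - b` or `a = 1/2`. -/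
theorem theoremB_mellin (a b s : ℝ) (hb0 : 0 < b) (hb : b < 1 / 2)
    (hab : a = 1 - b ∨ a = 1 / 2) (hs1 : -2 * a < s) (hs2 : s < b) :
    (∫ x in Ioi (0 : ℝ), ∫ y in Ioi (0 : ℝ),
        (x + y) ^ s * betaPrimeDensity a b x * betaPrimeDensity a b y)
      = (Real.Gamma (2 * a + s) * Real.Gamma (b - s)
            / (Real.Gamma (2 * a) * Real.Gamma b))
        * (Real.Gamma (a + 1 / 2) / (Real.Gamma a * Real.Gamma (1 / 2)))
        * (Real.Gamma (1 / 2) / (Real.Gamma b * Real.Gamma (1 / 2 - b)))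
        * ∫ u in (0 : ℝ)..1, ∫ v in (0 : ℝ)..1,
            u ^ (a - 1) * (1 - u) ^ (-(1 / 2) : ℝ)
            * v ^ (b - 1) * (1 - v) ^ (-(1 / 2) - b)
            * (1 + Real.sqrt (u / v)) ^ s := by
  have ha : 0 < a := by rcases hab with rfl | rfl <;> linarith
  have hG1 : 0 < Real.Gamma (2 * a + s) := Real.Gamma_pos_of_pos (by linarith)
  have hG2 : 0 < Real.Gamma (b - s) := Real.Gamma_pos_of_pos (by linarith)
  have hG3 : 0 < Real.Gamma (2 * a + b) := Real.Gamma_pos_of_pos (by linarith)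
  have hG4 : 0 < Real.Gamma (2 * a) := Real.Gamma_pos_of_pos (by linarith)
  have hG5 : 0 < Real.Gamma (a + 1 / 2) := Real.Gamma_pos_of_pos (by linarith)
  have hG6 : 0 < Real.Gamma (1 / 2 - b) := Real.Gamma_pos_of_pos (by linarith)
  have hG7 : 0 < Real.Gamma (1 / 2) := Real.Gamma_pos_of_pos (by norm_num)
  have hG8 : 0 < Real.Gamma a := Real.Gamma_pos_of_pos ha
  have hG9 : 0 < Real.Gamma b := Real.Gamma_pos_of_pos hb0
  have hG10 : 0 < Real.Gamma (a + b) := Real.Gamma_pos_of_pos (by linarith)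
  have hrel := setLIntegral_sqrt_ratio_eq_setLIntegral_ratioKernel hs1 hs2
  set c := Real.Gamma (a + b) ^ 2 * Real.Gamma (2 * a) * Real.Gamma (1 / 2 - b)
    / (4 * (Real.Gamma a * Real.Gamma (2 * a + b) * Real.Gamma (a + 1 / 2))) with hc
  have hkernel : ∫⁻ r in Ioi (0 : ℝ), ENNReal.ofReal (r ^ (2 * a + s - 1)) * ratioKernel a b (1 + r)
      = ENNReal.ofReal c
        * ∫⁻ r in Ioi (0 : ℝ), ENNReal.ofReal (r ^ (2 * a + s - 1)) * sumKernel a b (1 + r) := by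
    rw [← lintegral_const_mul' _ _ ENNReal.ofReal_ne_top]
    refine setLIntegral_congr_fun measurableSet_Ioi fun r (hr : 0 < r) => ?_
    rw [ratioKernel_eq_mul_sumKernel hb0 hb hab (by positivity)]
    exact mul_left_comm _ _ _
  have hL := setLIntegral_sum_ne_top ha hb0 (by linarith) hs1 hs2
  rw [hkernel, ← setLIntegral_sum_eq_setLIntegral_sumKernel, ← mul_assoc,
    ← ENNReal.ofReal_mul (by norm_num)] at hrel
  have hV := ENNReal.mul_ne_top (ENNReal.ofReal_ne_top (r := 4 * c)) hL
  rw [← hrel] at hV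
  replace hV := (ENNReal.lt_top_of_mul_ne_top_right hV
    (ENNReal.ofReal_pos.2 (by positivity)).ne').ne
  replace hrel := congrArg ENNReal.toReal hrel
  rw [ENNReal.toReal_mul, ENNReal.toReal_mul, ENNReal.toReal_ofReal (by positivity),
    ENNReal.toReal_ofReal (by positivity),
    ← setIntegral_setIntegral_eq_toReal measurableSet_Ioi measurableSet_Ioi (by fun_prop) _ hL,
    ← setIntegral_setIntegral_eq_toReal measurableSet_Ioo measurableSet_Ioo (by fun_prop) _ hV]
    at hrel
  · have hdensity : ∀ x y : ℝ, (x + y) ^ s * betaPrimeDensity a b x * betaPrimeDensity a b y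
        = (Real.Gamma (a + b) / (Real.Gamma a * Real.Gamma b)) ^ 2 * ((x + y) ^ s
        * (x ^ (a - 1) * (1 + x) ^ (-(a + b))) * (y ^ (a - 1) * (1 + y) ^ (-(a + b)))) :=
      fun x y => by
        simp only [betaPrimeDensity]
        ring
    simp_rw [hdensity, integral_const_mul, intervalIntegral.integral_of_le zero_le_one,
      integral_Ioc_eq_integral_Ioo]
    rw [mul_comm (4 * c), ← div_eq_iff (by positivity)] at hrel
    rw [← hrel, hc]
    field_simp
  · intro u hu v hv
    have h1 := hu.1
    have h2 := sub_pos.2 hu.2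
    have h3 := hv.1
    have h4 := sub_pos.2 hv.2
    positivity
  · intro x (hx : 0 < x) y (hy : 0 < y)
    positivity
end

section
/- Let a, b > 0 and let s be a real number with −2a < s < b. Then ∫₀^∞ ∫₀^∞ (x+y)^s f_{a,b}(x) f_{a,b}(y) dx dy = [2^{2a+s} Γ(a+b)² Γ(2b−s) Γ(2a+s) / (Γ(2a) Γ(b)² Γ(2a+2b))] · ∑_{n=0}^∞ (a+s/2)_n (a+(s+1)/2)_n (1/2)_n / ((a+1/2)_n (a+b+1/2)_n n!), where the series converges absolutely (its parametric excess equals b − s > 0). -/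
open MeasureTheory Set

/-- The Pochhammer symbol `(x)_n` for a real `x`. -/
noncomputable def pochhammer' (x : ℝ) (n : ℕ) : ℝ := (ascPochhammer ℝ n).eval x

open ENNReal ProbabilityTheory

theorem pochhammer'_pos {x : ℝ} (hx : 0 < x) (n : ℕ) : 0 < pochhammer' x n :=
  ascPochhammer_pos n x hx

theorem Gamma_add_nat_eq_pochhammer'_mul {x : ℝ} (hx : 0 < x) (n : ℕ) :
    Real.Gamma (x + n) = pochhammer' x n * Real.Gamma x := by
  induction n with
  | zero => simp [pochhammer']
  | succ n ih =>
    have h : pochhammer' x (n + 1) = pochhammer' x n * (x + n) := by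
      simp [pochhammer', ascPochhammer_succ_eval]
    have hn : x + n ≠ 0 := by positivity
    rw [h, Nat.cast_succ, ← add_assoc, Real.Gamma_add_one hn, ih]
    ring

theorem pochhammer'_two_mul (x : ℝ) (n : ℕ) :
    pochhammer' (2 * x) (2 * n) = 4 ^ n * pochhammer' x n * pochhammer' (x + 1 / 2) n := by
  induction n with
  | zero => simp [pochhammer']
  | succ n ih =>
    simp only [pochhammer'] at ih ⊢
    simp only [show 2 * (n + 1) = 2 * n + 1 + 1 from rfl, ascPochhammer_succ_eval, ih]
    push_cast
    ring

/-- The binomial series for a real exponent. -/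
theorem hasSum_pochhammer'_div_factorial_mul_pow (c : ℝ) {z : ℝ} (hz : |z| < 1) :
    HasSum (fun n : ℕ => pochhammer' c n / n.factorial * z ^ n) ((1 - z) ^ (-c)) := by
  have h := (Real.one_div_one_sub_rpow_hasFPowerSeriesOnBall_zero c).hasSum (y := z)
    (by simpa [enorm_eq_nnnorm, ← NNReal.coe_lt_coe] using hz)
  have hcoef (n : ℕ) : Ring.choose (c + n - 1) n = pochhammer' c n / n.factorial := by
    have h1 := Ring.factorial_nsmul_multichoose_eq_ascPochhammer c n
    rw [Polynomial.ascPochhammer_smeval_eq_eval, Ring.multichoose_eq, nsmul_eq_mul] at h1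
    rw [pochhammer', ← h1]
    field_simp
  have hz' : 0 ≤ 1 - z := by linarith [(abs_lt.mp hz).2]
  simpa [FormalMultilinearSeries.ofScalars_apply_eq, hcoef, Real.rpow_neg hz', mul_comm] using h

/-- Euler's beta integral as a lower Lebesgue integral. -/
theorem lintegral_Ioo_rpow_mul_one_sub_rpow {p q : ℝ} (hp : 0 < p) (hq : 0 < q) :
    ∫⁻ v in Ioo (0 : ℝ) 1, .ofReal (v ^ (p - 1) * (1 - v) ^ (q - 1)) = .ofReal (beta p q) := by
  have hB := beta_pos hp hq
  have h := lintegral_betaPDF_eq_one hp hq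
  rw [lintegral_betaPDF] at h
  simp_rw [mul_assoc, ofReal_mul (one_div_pos.2 hB).le] at h
  rw [lintegral_const_mul _ (by fun_prop)] at h
  have h2 : ENNReal.ofReal (beta p q) * ENNReal.ofReal (1 / beta p q) = 1 := by
    rw [← ofReal_mul hB.le, mul_one_div_cancel hB.ne', ofReal_one]
  rw [← mul_one (ENNReal.ofReal (beta p q)), ← h, ← mul_assoc, h2, one_mul]

/-- The beta prime form of the beta integral. -/
theorem lintegral_Ioi_rpow_mul_one_add_div_rpow {p q c : ℝ} (hp : 0 < p) (hq : 0 < q)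
    (hc : 0 < c) :
    ∫⁻ t in Ioi (0 : ℝ), .ofReal (t ^ (p - 1) * (1 + t / c) ^ (-(p + q)))
      = .ofReal (c ^ p * beta p q) := by
  have himg : (fun w : ℝ => c * w / (1 - w)) '' Ioo 0 1 = Ioi 0 := by
    ext t
    simp only [mem_image, mem_Ioo, mem_Ioi]
    constructor
    · rintro ⟨w, ⟨h0, h1⟩, rfl⟩
      have : 0 < 1 - w := by linarith
      positivity
    · intro ht
      refine ⟨t / (c + t), ⟨by positivity, ?_⟩, ?_⟩
      · rw [div_lt_one (by positivity)]; linarith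
      · have : (1 : ℝ) - t / (c + t) = c / (c + t) := by field_simp; ring
        rw [this]; field_simp
  have hderiv : ∀ w ∈ Ioo (0 : ℝ) 1,
      HasDerivWithinAt (fun w : ℝ => c * w / (1 - w)) (c / (1 - w) ^ 2) (Ioo 0 1) w := by
    intro w hw
    have h1 : 1 - w ≠ 0 := by linarith [hw.2]
    have := ((hasDerivAt_id w).const_mul c).div ((hasDerivAt_id w).const_sub 1) h1
    refine (this.congr_deriv ?_).hasDerivWithinAt
    simp only [id]
    congr 1
    ring
  have hinj : InjOn (fun w : ℝ => c * w / (1 - w)) (Ioo 0 1) := by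
    intro w hw v hv h
    have h1 : 1 - w ≠ 0 := by linarith [hw.2]
    have h2 : 1 - v ≠ 0 := by linarith [hv.2]
    simp only at h
    rw [div_eq_div_iff h1 h2] at h
    have : c * (w - v) = 0 := by linear_combination h
    rcases mul_eq_zero.mp this with h | h <;> linarith
  rw [← himg, lintegral_image_eq_lintegral_abs_deriv_mul measurableSet_Ioo hderiv hinj,
    ofReal_mul (by positivity), ← lintegral_Ioo_rpow_mul_one_sub_rpow hp hq,
    ← lintegral_const_mul _ (by fun_prop)]
  refine setLIntegral_congr_fun measurableSet_Ioo fun w hw => ?_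
  have h0 : 0 < w := hw.1
  have h1 : 0 < 1 - w := by linarith [hw.2]
  rw [← ofReal_mul (abs_nonneg _), ← ofReal_mul (by positivity), abs_of_pos (by positivity)]
  congr 1
  have e : 1 + c * w / (1 - w) / c = (1 - w)⁻¹ := by field_simp; ring
  rw [e, Real.inv_rpow h1.le, Real.rpow_neg h1.le, inv_inv, Real.div_rpow (by positivity) h1.le,
    Real.mul_rpow hc.le h0.le, Real.rpow_sub_one hc.ne', Real.rpow_sub_one h1.ne' p,
    Real.rpow_sub_one h1.ne' q, Real.rpow_add h1]
  field_simp

theorem lintegral_Ioo_neg_one_one_one_sub_sq_rpow_mul_pow {a : ℝ} (ha : 0 < a) (n : ℕ) :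
    ∫⁻ r in Ioo (-1 : ℝ) 1, .ofReal ((1 - r ^ 2) ^ (a - 1) * r ^ (2 * n))
      = .ofReal (beta (n + 1 / 2) a) := by
  have key : ∀ S : Set ℝ, MeasurableSet S → InjOn (fun r : ℝ => r ^ 2) S →
      (fun r : ℝ => r ^ 2) '' S = Ioo 0 1 →
      ∫⁻ r in S, .ofReal ((1 - r ^ 2) ^ (a - 1) * r ^ (2 * n))
        = .ofReal (1 / 2) * .ofReal (beta (n + 1 / 2) a) := by
    intro S hS hinj himg
    rw [← lintegral_Ioo_rpow_mul_one_sub_rpow (p := n + 1 / 2) (by positivity) ha, ← himg,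
      lintegral_image_eq_lintegral_abs_deriv_mul (f' := fun r => 2 * r) hS
        (fun r _ => by simpa using (hasDerivAt_pow 2 r).hasDerivWithinAt) hinj,
      ← lintegral_const_mul _ (by fun_prop)]
    refine setLIntegral_congr_fun hS fun r hr => ?_
    have hr2 : r ^ 2 ∈ Ioo (0 : ℝ) 1 := himg ▸ mem_image_of_mem _ hr
    have hr0 : 0 < |r| := by
      rw [abs_pos]; rintro rfl; simp at hr2
    have e : (r ^ 2) ^ ((n : ℝ) + 1 / 2 - 1) = r ^ (2 * n) / |r| := by
      rw [← sq_abs, ← Real.rpow_natCast, ← Real.rpow_mul hr0.le, pow_mul, ← sq_abs, ← pow_mul,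
        ← Real.rpow_natCast |r| (2 * n), ← Real.rpow_sub_one hr0.ne']
      congr 1
      push_cast
      ring
    rw [← ofReal_mul (abs_nonneg _), ← ofReal_mul (by norm_num), e, abs_mul, abs_two]
    congr 1
    field_simp
  have hneg := key (Ioo (-1) 0) measurableSet_Ioo
    (fun x hx y hy h => by
      simp only [mem_Ioo] at hx hy h
      nlinarith [sq_eq_sq_iff_eq_or_eq_neg.mp h |>.resolve_right (by intro; linarith)])
    (by
      ext v
      simp only [mem_image, mem_Ioo]
      constructor
      · rintro ⟨r, ⟨h1, h2⟩, rfl⟩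
        constructor <;> nlinarith
      · rintro ⟨h1, h2⟩
        refine ⟨-√v, ⟨?_, by simpa using h1⟩, by rw [neg_sq, Real.sq_sqrt h1.le]⟩
        have : √v < 1 := by rw [Real.sqrt_lt' one_pos]; simpa using h2
        linarith)
  have hpos := key (Ioo 0 1) measurableSet_Ioo
    (fun x hx y hy h => by
      simp only [mem_Ioo] at hx hy h
      exact (sq_eq_sq₀ hx.1.le hy.1.le).mp h)
    (by
      ext v
      simp only [mem_image, mem_Ioo]
      constructor
      · rintro ⟨r, ⟨h1, h2⟩, rfl⟩
        constructor <;> nlinarith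
      · rintro ⟨h1, h2⟩
        refine ⟨√v, ⟨by simpa using h1, ?_⟩, Real.sq_sqrt h1.le⟩
        rw [Real.sqrt_lt' one_pos]; simpa using h2)
  rw [← Ioo_union_Ico_eq_Ioo (show (-1 : ℝ) < 0 by norm_num) zero_le_one,
    lintegral_union measurableSet_Ico
      (disjoint_left.mpr fun x hx hx' => absurd hx.2 (not_lt.mpr hx'.1)),
    setLIntegral_congr Ioo_ae_eq_Ico.symm, hneg, hpos, ← add_mul,
    ← ofReal_add (by norm_num) (by norm_num)]
  norm_num

/-- Integration over the quadrant in the coordinates sum and normalised difference. -/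
theorem lintegral_quadrant_eq_lintegral_sum_diff {F : ℝ → ℝ → ℝ≥0∞}
    (hF : Measurable (Function.uncurry F)) :
    ∫⁻ x in Ioi (0 : ℝ), ∫⁻ y in Ioi (0 : ℝ), F x y
      = ∫⁻ t in Ioi (0 : ℝ), ∫⁻ r in Ioo (-1 : ℝ) 1,
          .ofReal (t / 2) * F (t / 2 * (1 + r)) (t / 2 * (1 - r)) := by
  set H : ℝ → ℝ → ℝ≥0∞ := fun x y => (Ioi 0 ×ˢ Ioi 0).indicator (Function.uncurry F) (x, y)
    with hH
  have hHm : Measurable (Function.uncurry H) :=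
    hF.indicator (measurableSet_Ioi.prod measurableSet_Ioi)
  have h1 : ∫⁻ x in Ioi (0 : ℝ), ∫⁻ y in Ioi (0 : ℝ), F x y = ∫⁻ x, ∫⁻ y, H x y := by
    rw [← lintegral_indicator measurableSet_Ioi]
    congr 1 with x
    by_cases hx : 0 < x
    · rw [indicator_of_mem (mem_Ioi.mpr hx), ← lintegral_indicator measurableSet_Ioi]
      congr 1 with y
      simp [hH, indicator, hx]
    · simp [hH, indicator, hx]
  have h2 : ∫⁻ x, ∫⁻ y, H x y = ∫⁻ t, ∫⁻ x, H x (t - x) := by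
    rw [← lintegral_lintegral_swap (f := fun x t => H x (t - x))
      (hHm.comp (by fun_prop : Measurable fun z : ℝ × ℝ => (z.1, z.2 - z.1))).aemeasurable]
    congr 1 with x
    exact (lintegral_sub_right_eq_self (H x) x).symm
  rw [h1, h2, ← lintegral_indicator measurableSet_Ioi]
  congr 1 with t
  by_cases ht : 0 < t
  · have himg : (fun r : ℝ => t / 2 * (1 + r)) '' Ioo (-1) 1 = Ioo 0 t := by
      have := image_affine_Ioo (half_pos ht) (t / 2) (-1) 1
      rw [show (fun r : ℝ => t / 2 * (1 + r)) = fun r => t / 2 * r + t / 2 by ext; ring, this]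
      congr 1 <;> ring
    have h3 : ∫⁻ x, H x (t - x) = ∫⁻ x in Ioo 0 t, F x (t - x) := by
      rw [← lintegral_indicator measurableSet_Ioo]
      congr 1 with x
      simp [hH, indicator]
    rw [indicator_of_mem (mem_Ioi.mpr ht), h3, ← himg,
      lintegral_image_eq_lintegral_abs_deriv_mul (f' := fun _ => t / 2) measurableSet_Ioo
        (fun r _ => by
          simpa using (((hasDerivAt_id r).const_add 1).const_mul (t / 2)).hasDerivWithinAt)
        (fun x _ y _ h => by
          have := mul_left_cancel₀ (half_pos ht).ne' h
          linarith)]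
    congr 1 with r
    rw [abs_of_pos (half_pos ht)]
    congr 2
    ring
  · rw [indicator_of_notMem (by simpa using ht)]
    refine lintegral_eq_zero_of_ae_eq_zero (.of_forall fun x => ?_)
    simp only [hH, Pi.zero_apply]
    refine indicator_of_notMem (fun h => ht ?_) _
    have h4 : 0 < x ∧ 0 < t - x := h
    linarith [h4.1, h4.2]

/-- The unnormalised integrand of the Mellin transform of the sum of two beta prime variables. -/
noncomputable def mellinKernel (a c s x y : ℝ) : ℝ :=
  (x + y) ^ s * (x ^ (a - 1) * (1 + x) ^ (-c)) * (y ^ (a - 1) * (1 + y) ^ (-c))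

theorem measurable_mellinKernel (a c s : ℝ) :
    Measurable (Function.uncurry (mellinKernel a c s)) := by
  unfold mellinKernel
  fun_prop

theorem mellinKernel_nonneg (a c s : ℝ) {x y : ℝ} (hx : 0 < x) (hy : 0 < y) :
    0 ≤ mellinKernel a c s x y := by
  unfold mellinKernel
  positivity

theorem hasSum_mellinKernel (a b s : ℝ) {t r : ℝ} (ht : 0 < t) (hr : r ∈ Ioo (-1 : ℝ) 1) :
    HasSum (fun n : ℕ => 2 ^ (1 - 2 * a) / 4 ^ n * (pochhammer' (a + b) n / n.factorial) *
        (t ^ (2 * a + s + 2 * n - 1) * (1 + t / 2) ^ (-(2 * a + s + 2 * n + (2 * b - s)))) *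
        ((1 - r ^ 2) ^ (a - 1) * r ^ (2 * n)))
      (t / 2 * mellinKernel a (a + b) s (t / 2 * (1 + r)) (t / 2 * (1 - r))) := by
  obtain ⟨hr1, hr2⟩ := hr
  have h1 : 0 < 1 + r := by linarith
  have h2 : 0 < 1 - r := by linarith
  have hu : 0 < 1 + t / 2 := by positivity
  have hrr : 0 < 1 - r ^ 2 := by nlinarith
  set w := t / 2 / (1 + t / 2) with hw
  have hw0 : 0 < w := by positivity
  have hw1 : w < 1 := by rw [hw, div_lt_one hu]; linarith
  have hz1 : (r * w) ^ 2 < 1 := by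
    rw [mul_pow]
    have : w ^ 2 < 1 := by nlinarith
    nlinarith [sq_nonneg r, sq_nonneg w]
  have hz : |(r * w) ^ 2| < 1 := by rwa [abs_of_nonneg (sq_nonneg _)]
  have hpow (x : ℝ) (hx : 0 < x) (e : ℝ) : (x ^ 2) ^ e = x ^ (2 * e) := by
    rw [← Real.rpow_natCast, ← Real.rpow_mul hx.le]
    simp
  have hprod : (t / 2 * (1 + r)) ^ (a - 1) * (t / 2 * (1 - r)) ^ (a - 1)
      = (t / 2) ^ (2 * (a - 1)) * (1 - r ^ 2) ^ (a - 1) := by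
    rw [← Real.mul_rpow (by positivity) (by positivity), ← hpow _ (by positivity),
      ← Real.mul_rpow (by positivity) hrr.le]
    ring_nf
  have hquad : (1 + t / 2 * (1 + r)) ^ (-(a + b)) * (1 + t / 2 * (1 - r)) ^ (-(a + b))
      = (1 + t / 2) ^ (2 * -(a + b)) * (1 - (r * w) ^ 2) ^ (-(a + b)) := by
    rw [← Real.mul_rpow (by positivity) (by positivity), ← hpow _ hu,
      ← Real.mul_rpow (by positivity) (by linarith)]
    congr 1
    rw [hw]
    field_simp
    ring
  have hker : t / 2 * mellinKernel a (a + b) s (t / 2 * (1 + r)) (t / 2 * (1 - r))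
      = t / 2 * t ^ s * ((t / 2) ^ (2 * (a - 1)) * (1 - r ^ 2) ^ (a - 1)) *
        (1 + t / 2) ^ (2 * -(a + b)) * (1 - (r * w) ^ 2) ^ (-(a + b)) := by
    rw [mul_assoc _ ((1 + t / 2) ^ _), ← hquad, ← hprod, mellinKernel,
      show t / 2 * (1 + r) + t / 2 * (1 - r) = t by ring]
    ring
  rw [hker]
  refine ((hasSum_pochhammer'_div_factorial_mul_pow (a + b) hz).mul_left _).congr_fun
    fun n => ?_
  have e1 : t ^ (2 * a + s + 2 * n - 1) = t ^ (2 * (a - 1)) * t ^ s * t * t ^ (2 * n) := by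
    rw [← Real.rpow_natCast t (2 * n), ← Real.rpow_add ht, ← Real.rpow_add_one ht.ne',
      ← Real.rpow_add ht]
    congr 1
    push_cast
    ring
  have e2 : (1 + t / 2) ^ (-(2 * a + s + 2 * n + (2 * b - s)))
      = (1 + t / 2) ^ (2 * -(a + b)) / (1 + t / 2) ^ (2 * n) := by
    rw [← Real.rpow_natCast _ (2 * n), ← Real.rpow_sub hu]
    congr 1
    push_cast
    ring
  have e3 : (2 : ℝ) ^ (1 - 2 * a) = 1 / (2 * 2 ^ (2 * (a - 1))) := by
    rw [show 1 - 2 * a = -(2 * (a - 1) + 1) by ring, Real.rpow_neg two_pos.le,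
      Real.rpow_add_one two_ne_zero, one_div, mul_comm]
  rw [e1, e2, e3, Real.div_rpow ht.le two_pos.le, hw, show (4 : ℝ) = 2 ^ 2 by norm_num,
    ← pow_mul, ← pow_mul, mul_pow, div_pow, div_pow]
  generalize 1 + t / 2 = u at hu ⊢
  field_simp

theorem lintegral_mellinKernel_eq_tsum {a b s : ℝ} (ha : 0 < a) (hb : 0 < b)
    (hs1 : -2 * a < s) (hs2 : s < 2 * b) :
    ∫⁻ x in Ioi (0 : ℝ), ∫⁻ y in Ioi (0 : ℝ), .ofReal (mellinKernel a (a + b) s x y)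
      = ∑' n : ℕ, .ofReal (2 ^ (1 - 2 * a) / 4 ^ n * (pochhammer' (a + b) n / n.factorial) *
          (2 ^ (2 * a + s + 2 * n) * beta (2 * a + s + 2 * n) (2 * b - s)) *
          beta (n + 1 / 2) a) := by
  rw [lintegral_quadrant_eq_lintegral_sum_diff
    (F := fun x y => .ofReal (mellinKernel a (a + b) s x y))
    (measurable_mellinKernel a (a + b) s).ennreal_ofReal]
  set k : ℕ → ℝ := fun n => 2 ^ (1 - 2 * a) / 4 ^ n * (pochhammer' (a + b) n / n.factorial)
    with hk
  have hk0 (n : ℕ) : 0 ≤ k n := by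
    have := pochhammer'_pos (add_pos ha hb) n
    positivity
  set g : ℕ → ℝ → ℝ := fun n t =>
    t ^ (2 * a + s + 2 * n - 1) * (1 + t / 2) ^ (-(2 * a + s + 2 * n + (2 * b - s))) with hg
  set h : ℕ → ℝ → ℝ := fun n r => (1 - r ^ 2) ^ (a - 1) * r ^ (2 * n) with hh
  have hgm (n : ℕ) : Measurable (g n) := by fun_prop
  have hhm (n : ℕ) : Measurable (h n) := by fun_prop
  have hexp : ∀ t ∈ Ioi (0 : ℝ), ∀ r ∈ Ioo (-1 : ℝ) 1,
      ENNReal.ofReal (t / 2) *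
          .ofReal (mellinKernel a (a + b) s (t / 2 * (1 + r)) (t / 2 * (1 - r)))
        = ∑' n, ENNReal.ofReal (k n) * .ofReal (g n t) * .ofReal (h n r) := by
    intro t (ht : 0 < t) r hr
    have hsum := hasSum_mellinKernel a b s ht hr
    have hg0 (n : ℕ) : 0 ≤ g n t := by positivity
    have hh0 (n : ℕ) : 0 ≤ h n r := by
      have : 0 < 1 - r ^ 2 := by nlinarith [hr.1, hr.2]
      have := (even_two_mul n).pow_nonneg r
      positivity
    rw [← ofReal_mul (by positivity), ← hsum.tsum_eq,
      ofReal_tsum_of_nonneg (fun n => mul_nonneg (mul_nonneg (hk0 n) (hg0 n)) (hh0 n))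
        hsum.summable]
    congr 1 with n
    rw [← ofReal_mul (hk0 n), ← ofReal_mul (mul_nonneg (hk0 n) (hg0 n))]
  calc
    _ = ∫⁻ t in Ioi (0 : ℝ), ∫⁻ r in Ioo (-1 : ℝ) 1,
          ∑' n, ENNReal.ofReal (k n) * .ofReal (g n t) * .ofReal (h n r) :=
      setLIntegral_congr_fun measurableSet_Ioi fun t ht =>
        setLIntegral_congr_fun measurableSet_Ioo (hexp t ht)
    _ = ∫⁻ t in Ioi (0 : ℝ), ∑' n,
          ENNReal.ofReal (k n) * .ofReal (g n t) * .ofReal (beta (n + 1 / 2) a) := by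
      congr 1 with t
      rw [lintegral_tsum fun n => by fun_prop]
      congr 1 with n
      rw [lintegral_const_mul _ (by fun_prop),
        lintegral_Ioo_neg_one_one_one_sub_sq_rpow_mul_pow ha]
    _ = _ := by
      rw [lintegral_tsum fun n => by fun_prop]
      congr 1 with n
      have hp : 0 < 2 * a + s + 2 * n := by
        have : (0 : ℝ) ≤ n := n.cast_nonneg
        linarith
      have hq : 0 < 2 * b - s := by linarith
      rw [lintegral_mul_const _ (by fun_prop), lintegral_const_mul _ (by fun_prop),
        lintegral_Ioi_rpow_mul_one_add_div_rpow hp hq two_pos, ← ofReal_mul (hk0 n),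
        ← ofReal_mul]
      have := beta_pos hp hq
      have := hk0 n
      positivity

theorem lintegral_mellinKernel_ne_top {a b s : ℝ} (ha : 0 < a) (hb : 0 < b)
    (hs1 : -2 * a < s) (hs2 : s < b) :
    ∫⁻ x in Ioi (0 : ℝ), ∫⁻ y in Ioi (0 : ℝ), .ofReal (mellinKernel a (a + b) s x y) ≠ ∞ := by
  set g : ℝ → ℝ → ℝ := fun p x => x ^ (p - 1) * (1 + x) ^ (-(a + b)) with hg
  have hgm (p : ℝ) : Measurable (g p) := by fun_prop
  have hg0 (p : ℝ) {x : ℝ} (hx : 0 < x) : 0 ≤ g p x := by positivity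
  have hadd {x : ℝ} (hx : 0 < x) (e : ℝ) : x ^ e * g a x = g (a + e) x := by
    rw [hg, ← mul_assoc, ← Real.rpow_add hx]
    ring_nf
  have hfin {p : ℝ} (hp : 0 < p) (hp' : p < a + b) :
      ∫⁻ x in Ioi (0 : ℝ), .ofReal (g p x) ≠ ∞ := by
    have h := lintegral_Ioi_rpow_mul_one_add_div_rpow hp (sub_pos.mpr hp') one_pos
    simp only [div_one, add_sub_cancel] at h
    rw [h]
    exact ofReal_ne_top
  have hfin2 {p q : ℝ} (hp : 0 < p) (hp' : p < a + b) (hq : 0 < q) (hq' : q < a + b) :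
      ∫⁻ x in Ioi (0 : ℝ), ∫⁻ y in Ioi (0 : ℝ),
        ENNReal.ofReal (g p x) * .ofReal (g q y) ≠ ∞ := by
    rw [lintegral_lintegral_mul (by fun_prop) (by fun_prop)]
    exact mul_ne_top (hfin hp hp') (hfin hq hq')
  rcases le_or_gt 0 s with hs | hs
  · have hbound : ∀ x ∈ Ioi (0 : ℝ), ∀ y ∈ Ioi (0 : ℝ),
        ENNReal.ofReal (mellinKernel a (a + b) s x y) ≤ .ofReal (2 ^ s) *
          (.ofReal (g (a + s) x) * .ofReal (g a y) + .ofReal (g a x) * .ofReal (g (a + s) y)) := by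
      intro x (hx : 0 < x) y (hy : 0 < y)
      rw [← ofReal_mul (hg0 _ hx), ← ofReal_mul (hg0 _ hx),
        ← ofReal_add (mul_nonneg (hg0 _ hx) (hg0 _ hy)) (mul_nonneg (hg0 _ hx) (hg0 _ hy)),
        ← ofReal_mul (by positivity)]
      refine ofReal_le_ofReal ?_
      have hle : (x + y) ^ s ≤ 2 ^ s * (x ^ s + y ^ s) := by
        rcases le_total x y with h | h
        · calc (x + y) ^ s ≤ (2 * y) ^ s := by gcongr; linarith
            _ = 2 ^ s * y ^ s := Real.mul_rpow two_pos.le hy.le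
            _ ≤ _ := by gcongr; linarith [Real.rpow_nonneg hx.le s]
        · calc (x + y) ^ s ≤ (2 * x) ^ s := by gcongr; linarith
            _ = 2 ^ s * x ^ s := Real.mul_rpow two_pos.le hx.le
            _ ≤ _ := by gcongr; linarith [Real.rpow_nonneg hy.le s]
      calc mellinKernel a (a + b) s x y = (x + y) ^ s * (g a x * g a y) := by
            rw [mellinKernel, mul_assoc]
        _ ≤ 2 ^ s * (x ^ s + y ^ s) * (g a x * g a y) :=
            mul_le_mul_of_nonneg_right hle (mul_nonneg (hg0 _ hx) (hg0 _ hy))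
        _ = _ := by rw [← hadd hx, ← hadd hy]; ring
    refine ne_top_of_le_ne_top ?_ (setLIntegral_mono' measurableSet_Ioi fun x hx =>
      setLIntegral_mono' measurableSet_Ioi (hbound x hx))
    have hsplit (x : ℝ) : ∫⁻ y in Ioi (0 : ℝ), ENNReal.ofReal (2 ^ s) *
          (.ofReal (g (a + s) x) * .ofReal (g a y) + .ofReal (g a x) * .ofReal (g (a + s) y))
        = .ofReal (2 ^ s) * ((∫⁻ y in Ioi (0 : ℝ), .ofReal (g (a + s) x) * .ofReal (g a y))
          + ∫⁻ y in Ioi (0 : ℝ), .ofReal (g a x) * .ofReal (g (a + s) y)) := by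
      rw [lintegral_const_mul _ (by fun_prop), lintegral_add_left (by fun_prop)]
    simp_rw [hsplit]
    rw [lintegral_const_mul' _ _ ofReal_ne_top, lintegral_add_left (by fun_prop)]
    exact mul_ne_top ofReal_ne_top (add_ne_top.mpr
      ⟨hfin2 (by linarith) (by linarith) ha (by linarith),
        hfin2 ha (by linarith) (by linarith) (by linarith)⟩)
  · have hbound : ∀ x ∈ Ioi (0 : ℝ), ∀ y ∈ Ioi (0 : ℝ),
        ENNReal.ofReal (mellinKernel a (a + b) s x y)
          ≤ .ofReal (g (a + s / 2) x) * .ofReal (g (a + s / 2) y) := by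
      intro x (hx : 0 < x) y (hy : 0 < y)
      rw [← ofReal_mul (hg0 _ hx)]
      refine ofReal_le_ofReal ?_
      have hle : (x + y) ^ s ≤ x ^ (s / 2) * y ^ (s / 2) := by
        calc (x + y) ^ s = ((x + y) ^ 2) ^ (s / 2) := by
              rw [← Real.rpow_natCast, ← Real.rpow_mul (by positivity)]
              congr 1
              push_cast
              ring
          _ ≤ (x * y) ^ (s / 2) :=
              Real.rpow_le_rpow_of_nonpos (by positivity) (by nlinarith) (by linarith)
          _ = _ := Real.mul_rpow hx.le hy.le
      calc mellinKernel a (a + b) s x y = (x + y) ^ s * (g a x * g a y) := by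
            rw [mellinKernel, mul_assoc]
        _ ≤ x ^ (s / 2) * y ^ (s / 2) * (g a x * g a y) :=
            mul_le_mul_of_nonneg_right hle (mul_nonneg (hg0 _ hx) (hg0 _ hy))
        _ = _ := by rw [← hadd hx, ← hadd hy]; ring
    exact ne_top_of_le_ne_top (hfin2 (by linarith) (by linarith) (by linarith) (by linarith))
      (setLIntegral_mono' measurableSet_Ioi fun x hx =>
        setLIntegral_mono' measurableSet_Ioi (hbound x hx))

/-- Each term of the expansion of the Mellin transform is a multiple of a `₃F₂` coefficient. -/
theorem mellin_coeff_eq_hypergeometric_coeff {a b s : ℝ} (ha : 0 < a) (hb : 0 < b)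
    (hs1 : -2 * a < s) (n : ℕ) :
    2 ^ (1 - 2 * a) / 4 ^ n * (pochhammer' (a + b) n / n.factorial) *
        (2 ^ (2 * a + s + 2 * n) * beta (2 * a + s + 2 * n) (2 * b - s)) * beta (n + 1 / 2) a
      = 2 ^ (2 * a + s) * Real.Gamma a ^ 2 * Real.Gamma (2 * b - s) * Real.Gamma (2 * a + s)
          / (Real.Gamma (2 * a) * Real.Gamma (2 * a + 2 * b)) *
        (pochhammer' (a + s / 2) n * pochhammer' (a + (s + 1) / 2) n * pochhammer' (1 / 2) n
          / (pochhammer' (a + 1 / 2) n * pochhammer' (a + b + 1 / 2) n * (n.factorial : ℝ))) := by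
  have h2as : 0 < 2 * a + s := by linarith
  have G1 : Real.Gamma (2 * a + s + 2 * n)
      = 4 ^ n * pochhammer' (a + s / 2) n * pochhammer' (a + (s + 1) / 2) n
        * Real.Gamma (2 * a + s) := by
    have h := pochhammer'_two_mul (a + s / 2) n
    rw [show 2 * (a + s / 2) = 2 * a + s by ring,
      show a + s / 2 + 1 / 2 = a + (s + 1) / 2 by ring] at h
    rw [← h, ← Gamma_add_nat_eq_pochhammer'_mul h2as]
    push_cast
    rfl
  have G2 : Real.Gamma (2 * a + s + 2 * n + (2 * b - s))
      = 4 ^ n * pochhammer' (a + b) n * pochhammer' (a + b + 1 / 2) n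
        * Real.Gamma (2 * a + 2 * b) := by
    have h := pochhammer'_two_mul (a + b) n
    rw [← h, mul_add, ← Gamma_add_nat_eq_pochhammer'_mul (by positivity)]
    push_cast
    ring_nf
  have G3 : Real.Gamma (n + 1 / 2) = pochhammer' (1 / 2) n * √Real.pi := by
    rw [add_comm, Gamma_add_nat_eq_pochhammer'_mul (by norm_num), Real.Gamma_one_half_eq]
  have G4 : Real.Gamma (n + 1 / 2 + a) = pochhammer' (a + 1 / 2) n * Real.Gamma (a + 1 / 2) := by
    rw [← Gamma_add_nat_eq_pochhammer'_mul (by positivity)]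
    ring_nf
  have hdup := Real.Gamma_mul_Gamma_add_half a
  have e2 : (2 : ℝ) ^ (2 * a + s + 2 * n) = 2 ^ (2 * a + s) * 4 ^ n := by
    rw [Real.rpow_add two_pos, Real.rpow_mul two_pos.le]
    norm_num
  have p1 := pochhammer'_pos (add_pos ha hb) n
  have p2 := pochhammer'_pos (by positivity : 0 < a + b + 1 / 2) n
  have p3 := pochhammer'_pos (by positivity : 0 < a + 1 / 2) n
  have g1 := Real.Gamma_pos_of_pos ha
  have g2 := Real.Gamma_pos_of_pos (by positivity : 0 < a + 1 / 2)
  have g3 := Real.Gamma_pos_of_pos (by positivity : 0 < 2 * a)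
  have g4 := Real.Gamma_pos_of_pos (by positivity : 0 < 2 * a + 2 * b)
  rw [beta, beta, G1, G2, G3, G4, e2]
  generalize pochhammer' (a + s / 2) n = P₁, pochhammer' (a + (s + 1) / 2) n = P₂,
    pochhammer' (1 / 2) n = P₃, pochhammer' (a + 1 / 2) n = Q₁ at *
  generalize pochhammer' (a + b + 1 / 2) n = Q₂, Real.Gamma (a + 1 / 2) = G at *
  field_simp
  linear_combination -(P₁ * P₂ * P₃ * Real.Gamma (2 * b - s)) * hdup

/-- Proposition 4: the Mellin transform of `B'_{a,b} + B'_{a,b}` expressed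
through the absolutely convergent ₃F₂(1) series. -/
theorem betaPrime_conv_mellin_3F2 (a b s : ℝ) (ha : 0 < a) (hb : 0 < b)
    (hs1 : -2 * a < s) (hs2 : s < b) :
    Summable (fun n : ℕ =>
        pochhammer' (a + s / 2) n * pochhammer' (a + (s + 1) / 2) n * pochhammer' (1 / 2) n
          / (pochhammer' (a + 1 / 2) n * pochhammer' (a + b + 1 / 2) n * (n.factorial : ℝ))) ∧
    (∫ x in Ioi (0 : ℝ), ∫ y in Ioi (0 : ℝ),
        (x + y) ^ s * betaPrimeDensity a b x * betaPrimeDensity a b y)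
      = 2 ^ (2 * a + s) * Real.Gamma (a + b) ^ 2 * Real.Gamma (2 * b - s) * Real.Gamma (2 * a + s)
          / (Real.Gamma (2 * a) * Real.Gamma b ^ 2 * Real.Gamma (2 * a + 2 * b))
        * ∑' n : ℕ,
            pochhammer' (a + s / 2) n * pochhammer' (a + (s + 1) / 2) n * pochhammer' (1 / 2) n
              / (pochhammer' (a + 1 / 2) n * pochhammer' (a + b + 1 / 2) n * (n.factorial : ℝ)) := by
  set T : ℕ → ℝ := fun n =>
    pochhammer' (a + s / 2) n * pochhammer' (a + (s + 1) / 2) n * pochhammer' (1 / 2) n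
      / (pochhammer' (a + 1 / 2) n * pochhammer' (a + b + 1 / 2) n * (n.factorial : ℝ)) with hT
  set C : ℝ := 2 ^ (2 * a + s) * Real.Gamma a ^ 2 * Real.Gamma (2 * b - s)
    * Real.Gamma (2 * a + s) / (Real.Gamma (2 * a) * Real.Gamma (2 * a + 2 * b)) with hC
  have g1 := Real.Gamma_pos_of_pos ha
  have g2 := Real.Gamma_pos_of_pos hb
  have g3 := Real.Gamma_pos_of_pos (by positivity : 0 < 2 * a)
  have g4 := Real.Gamma_pos_of_pos (by positivity : 0 < 2 * a + 2 * b)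
  have g5 := Real.Gamma_pos_of_pos (by linarith : 0 < 2 * b - s)
  have g6 := Real.Gamma_pos_of_pos (by linarith : 0 < 2 * a + s)
  have hC0 : 0 < C := by positivity
  have hT0 (n : ℕ) : 0 ≤ T n := by
    have p1 := pochhammer'_pos (by linarith : 0 < a + s / 2) n
    have p2 := pochhammer'_pos (by linarith : 0 < a + (s + 1) / 2) n
    have p3 := pochhammer'_pos (by norm_num : (0 : ℝ) < 1 / 2) n
    have p4 := pochhammer'_pos (by positivity : 0 < a + 1 / 2) n
    have p5 := pochhammer'_pos (by positivity : 0 < a + b + 1 / 2) n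
    positivity
  have hL := lintegral_mellinKernel_eq_tsum ha hb hs1 (by linarith)
  have hfin := lintegral_mellinKernel_ne_top ha hb hs1 hs2
  simp_rw [mellin_coeff_eq_hypergeometric_coeff ha hb hs1] at hL
  have hsumC : Summable fun n => C * T n := by
    rw [hL] at hfin
    refine (ENNReal.summable_toReal hfin).congr fun n => ?_
    rw [toReal_ofReal (mul_nonneg hC0.le (hT0 n))]
  have hsum : Summable T := (summable_mul_left_iff hC0.ne').mp hsumC
  refine ⟨hsum, ?_⟩
  rw [← ofReal_tsum_of_nonneg (fun n => mul_nonneg hC0.le (hT0 n)) hsumC, tsum_mul_left] at hL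
  have hm := measurable_mellinKernel a (a + b) s
  set μ : Measure ℝ := volume.restrict (Ioi 0) with hμ
  have hprod : ∫⁻ z, .ofReal (Function.uncurry (mellinKernel a (a + b) s) z) ∂μ.prod μ
      = .ofReal (C * ∑' n, T n) := by
    rw [lintegral_prod _ hm.ennreal_ofReal.aemeasurable]
    exact hL
  have hnonneg : 0 ≤ᵐ[μ.prod μ] Function.uncurry (mellinKernel a (a + b) s) := by
    rw [hμ, Measure.prod_restrict]
    refine (ae_restrict_mem (measurableSet_Ioi.prod measurableSet_Ioi)).mono fun z hz => ?_
    exact mellinKernel_nonneg a (a + b) s hz.1 hz.2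
  have hint : Integrable (Function.uncurry (mellinKernel a (a + b) s)) (μ.prod μ) := by
    refine ⟨hm.aestronglyMeasurable, ?_⟩
    rw [hasFiniteIntegral_iff_ofReal hnonneg, hprod]
    exact ofReal_lt_top
  have hval : ∫ x, ∫ y, mellinKernel a (a + b) s x y ∂μ ∂μ = C * ∑' n, T n := by
    have h := integral_prod _ hint
    rw [integral_eq_lintegral_of_nonneg_ae hnonneg hm.aestronglyMeasurable, hprod,
      toReal_ofReal (mul_nonneg hC0.le (tsum_nonneg hT0))] at h
    exact h.symm
  have hfactor (x y : ℝ) : (x + y) ^ s * betaPrimeDensity a b x * betaPrimeDensity a b y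
      = (Real.Gamma (a + b) / (Real.Gamma a * Real.Gamma b)) ^ 2
        * mellinKernel a (a + b) s x y := by
    simp only [betaPrimeDensity, mellinKernel]
    ring
  simp_rw [hfactor, integral_const_mul, hval, hC]
  field_simp
end

section
/- Let a, b > 0 with a + b = 1/2, and let s be a real number with −2a < s < b. Then ∫₀^∞ ∫₀^∞ (x+y)^s f_{a,b}(x) f_{a,b}(y) dx dy = [Γ(2a+s)Γ(2b−s)/(Γ(2a)Γ(2b))] · [Γ(a+1/2)Γ(b+1/2)/(Γ(a)Γ(b)Γ(1/2)²)] · ∫₀^1 ∫₀^1 t^{a−1}(1−t)^{−1/2} u^{b−1}(1−u)^{−1/2} (t + 1/u)^s dt du. (This is the Mellin-transform form of the identity in law B'_{a,b} + B'_{a,b} = B'_{2a,2b} × (B_{a,1/2} + B_{b,1/2}^{−1}).) -/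
open MeasureTheory Set

theorem setLIntegral_eq_setLIntegral_abs_deriv_mul_of_invOn {s t : Set ℝ} {f f' g : ℝ → ℝ}
    (hs : MeasurableSet s) (hf : ∀ x ∈ s, HasDerivAt f (f' x) x) (hst : MapsTo f s t)
    (hts : MapsTo g t s) (h : InvOn g f s t) (F : ℝ → ENNReal) :
    ∫⁻ x in t, F x = ∫⁻ x in s, ENNReal.ofReal |f' x| * F (f x) := by
  have hbij : BijOn f s t := h.bijOn hst hts
  rw [← hbij.image_eq]
  exact lintegral_image_eq_lintegral_abs_deriv_mul hs
    (fun x hx => (hf x hx).hasDerivWithinAt) hbij.injOn F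

theorem lintegral_rpow_mul_one_sub_rpow {p q : ℝ} (hp : 0 < p) (hq : 0 < q) :
    ∫⁻ x in Ioo (0 : ℝ) 1, ENNReal.ofReal (x ^ (p - 1) * (1 - x) ^ (q - 1))
      = ENNReal.ofReal (Real.Gamma p * Real.Gamma q / Real.Gamma (p + q)) := by
  have hB := ProbabilityTheory.beta_pos hp hq
  have h := ProbabilityTheory.lintegral_betaPDF_eq_one hp hq
  rw [ProbabilityTheory.lintegral_betaPDF] at h
  simp_rw [mul_assoc, ENNReal.ofReal_mul (one_div_pos.2 hB).le] at h
  rw [lintegral_const_mul _ (by fun_prop)] at h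
  change _ = ENNReal.ofReal (ProbabilityTheory.beta p q)
  calc _ = ENNReal.ofReal (ProbabilityTheory.beta p q) *
        (ENNReal.ofReal (1 / ProbabilityTheory.beta p q) *
        ∫⁻ x in Ioo (0 : ℝ) 1, ENNReal.ofReal (x ^ (p - 1) * (1 - x) ^ (q - 1))) := by
        rw [← mul_assoc, ← ENNReal.ofReal_mul hB.le, mul_one_div_cancel hB.ne',
          ENNReal.ofReal_one, one_mul]
    _ = _ := by rw [h, mul_one]

theorem lintegral_rpow_div_add {c w : ℝ} (hc : 0 < c) (hc1 : c < 1) (hw : 0 < w) :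
    ∫⁻ z in Ioi (0 : ℝ), ENNReal.ofReal (z ^ (c - 1) / (w + z))
      = ENNReal.ofReal (Real.Gamma c * Real.Gamma (1 - c) * w ^ (c - 1)) := by
  have hB := lintegral_rpow_mul_one_sub_rpow hc (sub_pos.2 hc1)
  rw [setLIntegral_eq_setLIntegral_abs_deriv_mul_of_invOn (s := Ioo 0 1)
    (f := fun v => w * v / (1 - v)) (f' := fun v => w / (1 - v) ^ 2) (g := fun z => z / (w + z))
    measurableSet_Ioo]
  · rw [mul_comm, ENNReal.ofReal_mul (by positivity)]
    rw [add_sub_cancel, Real.Gamma_one, div_one] at hB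
    rw [← hB, ← lintegral_const_mul _ (by fun_prop)]
    refine setLIntegral_congr_fun measurableSet_Ioo fun v hv => ?_
    have h1 : 0 < 1 - v := sub_pos.2 hv.2
    have h0 : 0 < v := hv.1
    rw [← ENNReal.ofReal_mul (by positivity), ← ENNReal.ofReal_mul (by positivity),
      abs_of_pos (by positivity), Real.div_rpow (by positivity) h1.le,
      Real.mul_rpow hw.le h0.le, Real.rpow_sub_one h1.ne' (1 - c), Real.rpow_sub h1 1 c,
      Real.rpow_sub_one h1.ne' c, Real.rpow_one]
    congr 1
    field_simp
    ring
  · intro v hv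
    have h1 : 1 - v ≠ 0 := (sub_pos.2 hv.2).ne'
    exact (((hasDerivAt_id v).const_mul w).div ((hasDerivAt_id v).const_sub 1) h1).congr_deriv
      (by simp only [id]; ring)
  · intro v hv
    have h1 : 0 < 1 - v := sub_pos.2 hv.2
    have h0 : 0 < v := hv.1
    exact div_pos (by positivity) h1
  · intro z (hz : 0 < z)
    exact ⟨by positivity, (div_lt_one (by positivity)).2 (by linarith)⟩
  · constructor
    · intro v hv
      have h1 : 1 - v ≠ 0 := (sub_pos.2 hv.2).ne'
      simp only
      field_simp
      ring
    · intro z (hz : 0 < z)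
      have : 1 - z / (w + z) = w / (w + z) := by field_simp; ring
      simp only [this]
      field_simp

theorem rpow_neg_half_eq_inv_sqrt {x : ℝ} (hx : 0 ≤ x) : x ^ (-(1 / 2) : ℝ) = (√x)⁻¹ := by
  rw [Real.rpow_neg hx, Real.sqrt_eq_rpow]

/-- The Stieltjes transform of the arcsine law on `(α, β)`. -/
theorem lintegral_arcsine_div_add {α β r : ℝ} (hαβ : α < β) (hr : 0 < α + r) :
    ∫⁻ w in Ioo α β, ENNReal.ofReal (((w - α) * (β - w)) ^ (-(1 / 2) : ℝ) / (w + r))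
      = ENNReal.ofReal (Real.pi * ((α + r) * (β + r)) ^ (-(1 / 2) : ℝ)) := by
  have hB : 0 < β + r := by linarith
  have hD : 0 < β - α := by linarith
  have hI : ∫⁻ y in Ioi (0 : ℝ), ENNReal.ofReal ((1 + y ^ 2)⁻¹) = ENNReal.ofReal (Real.pi / 2) := by
    rw [← ofReal_integral_eq_lintegral_ofReal integrable_inv_one_add_sq.integrableOn
      (.of_forall fun y => by positivity), integral_Ioi_inv_one_add_sq]
    simp
  have hden : ∀ y : ℝ, 0 < (β + r) + (α + r) * y ^ 2 := fun y => by positivity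
  have hfα : ∀ y : ℝ, (α * (β + r) + β * (α + r) * y ^ 2) / ((β + r) + (α + r) * y ^ 2) - α
      = (α + r) * (β - α) * y ^ 2 / ((β + r) + (α + r) * y ^ 2) := fun y => by
    have := (hden y).ne'
    field_simp; ring
  have hfβ : ∀ y : ℝ, β - (α * (β + r) + β * (α + r) * y ^ 2) / ((β + r) + (α + r) * y ^ 2)
      = (β + r) * (β - α) / ((β + r) + (α + r) * y ^ 2) := fun y => by
    have := (hden y).ne'
    field_simp; ring
  have hfr : ∀ y : ℝ, (α * (β + r) + β * (α + r) * y ^ 2) / ((β + r) + (α + r) * y ^ 2) + r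
      = (α + r) * (β + r) * (1 + y ^ 2) / ((β + r) + (α + r) * y ^ 2) := fun y => by
    have := (hden y).ne'
    field_simp; ring
  rw [setLIntegral_eq_setLIntegral_abs_deriv_mul_of_invOn (s := Ioi 0)
    (f := fun y => (α * (β + r) + β * (α + r) * y ^ 2) / ((β + r) + (α + r) * y ^ 2))
    (f' := fun y => 2 * y * (α + r) * (β + r) * (β - α) / ((β + r) + (α + r) * y ^ 2) ^ 2)
    (g := fun w => √((β + r) * (w - α) / ((α + r) * (β - w))))
    measurableSet_Ioi]
  · have : Real.pi * ((α + r) * (β + r)) ^ (-(1 / 2) : ℝ)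
        = (2 * ((α + r) * (β + r)) ^ (-(1 / 2) : ℝ)) * (Real.pi / 2) := by ring
    rw [this, ENNReal.ofReal_mul (by positivity), ← hI, ← lintegral_const_mul _ (by fun_prop)]
    refine setLIntegral_congr_fun measurableSet_Ioi fun y (hy : 0 < y) => ?_
    have hdy := hden y
    simp only [hfα, hfβ, hfr]
    rw [← ENNReal.ofReal_mul (by positivity), ← ENNReal.ofReal_mul (by positivity),
      abs_of_pos (by positivity), rpow_neg_half_eq_inv_sqrt (by positivity),
      rpow_neg_half_eq_inv_sqrt (by positivity)]
    have : (α + r) * (β - α) * y ^ 2 / ((β + r) + (α + r) * y ^ 2) *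
        ((β + r) * (β - α) / ((β + r) + (α + r) * y ^ 2))
        = ((α + r) * (β + r)) * ((β - α) * y / ((β + r) + (α + r) * y ^ 2)) ^ 2 := by
      field_simp
    rw [this, Real.sqrt_mul (by positivity), Real.sqrt_sq (by positivity)]
    have hsq := Real.sq_sqrt (x := (α + r) * (β + r)) (by positivity)
    have hsp : 0 < √((α + r) * (β + r)) := by positivity
    congr 1
    field_simp
  · intro y _
    exact ((((hasDerivAt_pow 2 y).const_mul (β * (α + r))).const_add (α * (β + r))).div
      (((hasDerivAt_pow 2 y).const_mul (α + r)).const_add (β + r)) (hden y).ne').congr_deriv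
      (by norm_num; ring)
  · intro y (hy : 0 < y)
    have hdy := hden y
    constructor
    · rw [← sub_pos, hfα]; positivity
    · rw [← sub_pos, hfβ]; positivity
  · intro w hw
    have h1 := sub_pos.2 hw.1
    have h2 := sub_pos.2 hw.2
    exact Real.sqrt_pos.2 (by positivity)
  · constructor
    · intro y (hy : 0 < y)
      have hdy := hden y
      simp only [hfα, hfβ]
      rw [← Real.sqrt_sq hy.le]
      congr 1
      rw [Real.sqrt_sq hy.le]
      field_simp
    · intro w hw
      have h1 := sub_pos.2 hw.1
      have h2 := sub_pos.2 hw.2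
      simp only
      rw [Real.sq_sqrt (by positivity)]
      have hne : (β - w) + (w - α) ≠ 0 := by linarith
      field_simp
      ring

/-- `Real.rpow` with exponent `-1/2` vanishes at nonpositive bases, so such powers carry their own
indicator function. -/
theorem rpow_neg_half_of_nonpos {x : ℝ} (hx : x ≤ 0) : x ^ (-(1 / 2) : ℝ) = 0 := by
  rcases hx.eq_or_lt with rfl | hx
  · exact Real.zero_rpow (by norm_num)
  · rw [Real.rpow_def_of_neg hx, show (-(1 / 2) : ℝ) * Real.pi = -(Real.pi / 2) by ring,
      Real.cos_neg, Real.cos_pi_div_two, mul_zero]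

theorem rpow_neg_half_nonneg (x : ℝ) : 0 ≤ x ^ (-(1 / 2) : ℝ) := by
  rcases le_total x 0 with hx | hx
  · exact (rpow_neg_half_of_nonpos hx).ge
  · exact Real.rpow_nonneg hx _

/-- The function `z ↦ (1 + z + z² τ / 4) ^ (-1/2)` is the Stieltjes transform of
`w ↦ (w - 1 - w² τ / 4) ^ (-1/2) / π`. -/
theorem lintegral_quadratic_rpow_neg_half_div_add {τ z : ℝ} (hτ : τ ∈ Ioo (0 : ℝ) 1) (hz : 0 < z) :
    ∫⁻ w in Ioi (0 : ℝ), ENNReal.ofReal ((w - 1 - w ^ 2 * τ / 4) ^ (-(1 / 2) : ℝ) / (w + z))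
      = ENNReal.ofReal (Real.pi * (1 + z + z ^ 2 * τ / 4) ^ (-(1 / 2) : ℝ)) := by
  obtain ⟨ρ, hρ0, hρ1, rfl⟩ : ∃ ρ : ℝ, 0 < ρ ∧ ρ < 1 ∧ τ = (1 - ρ) * (1 + ρ) := by
    refine ⟨√(1 - τ), Real.sqrt_pos.2 (by linarith [hτ.2]), ?_, ?_⟩
    · rw [Real.sqrt_lt' one_pos]; linarith [hτ.1]
    · nlinarith [Real.sq_sqrt (x := 1 - τ) (by linarith [hτ.2])]
  have h1 : 0 < 1 - ρ := by linarith
  have h2 : 0 < 1 + ρ := by linarith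
  have hlt : 2 / (1 + ρ) < 2 / (1 - ρ) := by gcongr; linarith
  have hα : 0 < 2 / (1 + ρ) := by positivity
  have hq : ∀ w : ℝ, w - 1 - w ^ 2 * ((1 - ρ) * (1 + ρ)) / 4
      = (1 - ρ) * (1 + ρ) / 4 * ((w - 2 / (1 + ρ)) * (2 / (1 - ρ) - w)) := fun w => by
    field_simp; ring
  have hz' : 1 + z + z ^ 2 * ((1 - ρ) * (1 + ρ)) / 4
      = (1 - ρ) * (1 + ρ) / 4 * ((2 / (1 + ρ) + z) * (2 / (1 - ρ) + z)) := by
    field_simp; ring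
  have hk : 0 ≤ ((1 - ρ) * (1 + ρ) / 4) ^ (-(1 / 2) : ℝ) := by positivity
  rw [hz', Real.mul_rpow (by positivity) (by positivity), mul_left_comm, ENNReal.ofReal_mul hk,
    ← lintegral_arcsine_div_add hlt (by positivity), ← lintegral_const_mul _ (by fun_prop),
    ← lintegral_indicator measurableSet_Ioi, ← lintegral_indicator measurableSet_Ioo]
  congr 1
  ext w
  by_cases hw : w ∈ Ioo (2 / (1 + ρ)) (2 / (1 - ρ))
  · have h3 := sub_pos.2 hw.1
    have h4 := sub_pos.2 hw.2
    rw [indicator_of_mem hw, indicator_of_mem (show w ∈ Ioi 0 from hα.trans hw.1), hq,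
      Real.mul_rpow (by positivity) (by positivity), ← ENNReal.ofReal_mul hk, mul_div_assoc]
  · rw [indicator_of_notMem hw]
    refine indicator_apply_eq_zero.2 fun _ => ?_
    rw [hq, rpow_neg_half_of_nonpos, zero_div, ENNReal.ofReal_zero]
    refine mul_nonpos_of_nonneg_of_nonpos (by positivity) ?_
    rcases le_or_gt w (2 / (1 + ρ)) with h | h
    · exact mul_nonpos_of_nonpos_of_nonneg (by linarith) (by linarith)
    · have : 2 / (1 - ρ) ≤ w := not_lt.1 fun h' => hw ⟨h, h'⟩
      exact mul_nonpos_of_nonneg_of_nonpos (by linarith) (by linarith)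

theorem setIntegral_setIntegral_eq_toReal_lintegral {S T : Set ℝ} (hS : MeasurableSet S)
    (hT : MeasurableSet T) {F : ℝ → ℝ → ℝ} (hF : Measurable (Function.uncurry F))
    (hF0 : ∀ x ∈ S, ∀ y ∈ T, 0 ≤ F x y)
    (hfin : ∫⁻ x in S, ∫⁻ y in T, ENNReal.ofReal (F x y) ≠ ⊤) :
    ∫ x in S, ∫ y in T, F x y = (∫⁻ x in S, ∫⁻ y in T, ENNReal.ofReal (F x y)).toReal := by
  have hm : Measurable fun x => ∫⁻ y in T, ENNReal.ofReal (F x y) :=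
    Measurable.lintegral_prod_right' (f := fun p : ℝ × ℝ => ENNReal.ofReal (F p.1 p.2))
      hF.ennreal_ofReal
  rw [← integral_toReal hm.aemeasurable (ae_lt_top hm hfin)]
  refine setIntegral_congr_fun hS fun x hx => ?_
  exact integral_eq_lintegral_of_nonneg_ae
    ((ae_restrict_iff' hT).2 (.of_forall fun y hy => hF0 x hx y hy))
    (hF.comp measurable_prodMk_left).aestronglyMeasurable

theorem lintegral_Ioo_comp_mul_sub {z : ℝ} (hz : 0 < z) (h : ℝ → ENNReal) :
    ∫⁻ x in Ioo 0 z, h (x * (z - x))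
      = ∫⁻ τ in Ioo (0 : ℝ) 1,
          ENNReal.ofReal (z / 2 * (1 - τ) ^ (-(1 / 2) : ℝ)) * h (z ^ 2 * τ / 4) := by
  have hd : ∀ x : ℝ, HasDerivAt (fun x => 4 * (x * (z - x)) / z ^ 2) (4 * (z - 2 * x) / z ^ 2) x :=
    fun x => ((((hasDerivAt_id x).mul ((hasDerivAt_id x).const_sub z)).const_mul 4).div_const
      (z ^ 2)).congr_deriv (by simp only [id]; ring)
  have hone : ∀ x : ℝ, 1 - 4 * (x * (z - x)) / z ^ 2 = ((z - 2 * x) / z) ^ 2 := fun x => by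
    field_simp; ring
  have hcov : ∀ x : ℝ, x ≠ z / 2 →
      ENNReal.ofReal |4 * (z - 2 * x) / z ^ 2| *
        (ENNReal.ofReal (z / 4 * (1 - 4 * (x * (z - x)) / z ^ 2) ^ (-(1 / 2) : ℝ)) *
          h (z ^ 2 * (4 * (x * (z - x)) / z ^ 2) / 4)) = h (x * (z - x)) := by
    intro x hx
    have hx' : z - 2 * x ≠ 0 := fun h0 => hx (by linarith)
    have habs : 0 < |z - 2 * x| := abs_pos.2 hx'
    rw [← mul_assoc, ← ENNReal.ofReal_mul (abs_nonneg _), hone,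
      rpow_neg_half_eq_inv_sqrt (sq_nonneg _),
      Real.sqrt_sq_eq_abs, abs_div, abs_div, abs_mul, abs_of_pos hz,
      abs_of_pos (by positivity : (0 : ℝ) < z ^ 2), abs_of_pos (by norm_num : (0 : ℝ) < 4)]
    have h1 : 4 * |z - 2 * x| / z ^ 2 * (z / 4 * (|z - 2 * x| / z)⁻¹) = 1 := by field_simp
    have h2 : z ^ 2 * (4 * (x * (z - x)) / z ^ 2) / 4 = x * (z - x) := by field_simp
    rw [h1, h2, ENNReal.ofReal_one, one_mul]
  have hlow : ∫⁻ τ in Ioo (0 : ℝ) 1,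
      ENNReal.ofReal (z / 4 * (1 - τ) ^ (-(1 / 2) : ℝ)) * h (z ^ 2 * τ / 4)
        = ∫⁻ x in Ioo 0 (z / 2), h (x * (z - x)) := by
    rw [setLIntegral_eq_setLIntegral_abs_deriv_mul_of_invOn (s := Ioo 0 (z / 2))
      (g := fun τ => z * (1 - √(1 - τ)) / 2) measurableSet_Ioo (fun x _ => hd x)]
    · exact setLIntegral_congr_fun measurableSet_Ioo fun x hx =>
        hcov x hx.2.ne
    · intro x hx
      have h1 : 0 < z - 2 * x := by linarith [hx.2]
      have h2 : 0 < z - x := by linarith [hx.1]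
      have h3 := hx.1
      refine ⟨by positivity, sub_pos.1 ?_⟩
      rw [hone]
      positivity
    · intro τ hτ
      have h1 : 0 < √(1 - τ) := Real.sqrt_pos.2 (by linarith [hτ.2])
      have h2 : √(1 - τ) < 1 := (Real.sqrt_lt' one_pos).2 (by linarith [hτ.1])
      constructor <;> nlinarith
    · constructor
      · intro x hx
        have h1 : 0 < z - 2 * x := by linarith [hx.2]
        simp only [hone]
        rw [Real.sqrt_sq (by positivity)]
        field_simp
        ring
      · intro τ hτ
        have := Real.sq_sqrt (x := 1 - τ) (by linarith [hτ.2])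
        simp only
        field_simp
        linear_combination -4 * this
  have hhigh : ∫⁻ x in Ioo (z / 2) z, h (x * (z - x)) = ∫⁻ x in Ioo 0 (z / 2), h (x * (z - x)) := by
    rw [← lintegral_indicator measurableSet_Ioo, ← lintegral_indicator measurableSet_Ioo,
      ← lintegral_sub_left_eq_self _ z]
    congr 1
    ext x
    have hiff : z - x ∈ Ioo (z / 2) z ↔ x ∈ Ioo 0 (z / 2) := by
      constructor <;> intro hx <;> constructor <;> linarith [hx.1, hx.2]
    by_cases hx : x ∈ Ioo 0 (z / 2)
    · rw [indicator_of_mem hx, indicator_of_mem (hiff.2 hx), sub_sub_cancel, mul_comm]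
    · rw [indicator_of_notMem hx, indicator_of_notMem (mt hiff.1 hx)]
  have hsplit : ∫⁻ x in Ioo 0 z, h (x * (z - x))
      = (∫⁻ x in Ioo 0 (z / 2), h (x * (z - x))) + ∫⁻ x in Ioo (z / 2) z, h (x * (z - x)) := by
    rw [← Ioc_union_Ioo_eq_Ioo (b := z / 2) (by linarith) (by linarith),
      lintegral_union measurableSet_Ioo
        (disjoint_left.2 fun x hx hx' => (hx.2.trans_lt hx'.1).false),
      setLIntegral_congr Ioo_ae_eq_Ioc.symm]
  rw [hsplit, hhigh, ← hlow, ← two_mul, ← lintegral_const_mul' _ _ (by simp)]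
  refine setLIntegral_congr_fun measurableSet_Ioo fun τ _ => ?_
  rw [← mul_assoc, ← ENNReal.ofReal_ofNat, ← ENNReal.ofReal_mul (by norm_num)]
  ring_nf

/-- Integration over the positive quadrant of a function of `x + y` and `x * y`, in the coordinates
`z = x + y` and `τ = 4 x y / (x + y) ^ 2`. -/
theorem lintegral_Ioi_Ioi_comp_add_mul {H : ℝ → ℝ → ENNReal}
    (hH : Measurable (Function.uncurry H)) :
    ∫⁻ x in Ioi (0 : ℝ), ∫⁻ y in Ioi (0 : ℝ), H (x + y) (x * y)
      = ∫⁻ z in Ioi (0 : ℝ), ∫⁻ τ in Ioo (0 : ℝ) 1,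
          ENNReal.ofReal (z / 2 * (1 - τ) ^ (-(1 / 2) : ℝ)) * H z (z ^ 2 * τ / 4) := by
  have hHc : ∀ f g : ℝ × ℝ → ℝ, Measurable f → Measurable g → Measurable fun p => H (f p) (g p) :=
    fun f g hf hg => hH.comp (hf.prodMk hg)
  have hS : MeasurableSet {p : ℝ × ℝ | 0 < p.1 ∧ p.1 < p.2} :=
    (measurableSet_lt measurable_const measurable_fst).inter
      (measurableSet_lt measurable_fst measurable_snd)
  calc _ = ∫⁻ x, ∫⁻ z, {p : ℝ × ℝ | 0 < p.1 ∧ p.1 < p.2}.indicator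
          (fun p => H p.2 (p.1 * (p.2 - p.1))) (x, z) := by
        rw [← lintegral_indicator measurableSet_Ioi]
        congr 1
        ext x
        by_cases hx : 0 < x
        · rw [indicator_of_mem (show x ∈ Ioi 0 from hx), ← lintegral_indicator measurableSet_Ioi,
            ← lintegral_sub_right_eq_self _ x]
          congr 1
          ext z
          simp only [indicator, mem_Ioi, mem_ofPred_eq, hx, true_and, sub_pos, add_sub_cancel]
        · rw [indicator_of_notMem (by simpa using hx)]
          simp [indicator, hx]
    _ = ∫⁻ z, ∫⁻ x, {p : ℝ × ℝ | 0 < p.1 ∧ p.1 < p.2}.indicator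
          (fun p => H p.2 (p.1 * (p.2 - p.1))) (x, z) :=
        lintegral_lintegral_swap
          ((hHc _ _ measurable_snd (by fun_prop)).indicator hS).aemeasurable
    _ = ∫⁻ z in Ioi (0 : ℝ), ∫⁻ x in Ioo 0 z, H z (x * (z - x)) := by
        rw [← lintegral_indicator measurableSet_Ioi]
        congr 1
        ext z
        by_cases hz : 0 < z
        · rw [indicator_of_mem (show z ∈ Ioi 0 from hz), ← lintegral_indicator measurableSet_Ioo]
          rfl
        · rw [indicator_of_notMem (by simpa using hz)]
          refine lintegral_eq_zero_of_ae_eq_zero (.of_forall fun x => ?_)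
          exact indicator_of_notMem (fun hx => hz (hx.1.trans hx.2)) _
    _ = _ := setLIntegral_congr_fun measurableSet_Ioi fun z hz =>
        lintegral_Ioo_comp_mul_sub hz _

theorem pi_mul_lintegral_rpow_mul_quadratic_rpow_neg_half {c τ : ℝ} (hc : 0 < c) (hc1 : c < 1)
    (hτ : τ ∈ Ioo (0 : ℝ) 1) :
    ENNReal.ofReal Real.pi * ∫⁻ z in Ioi (0 : ℝ),
        ENNReal.ofReal (z ^ (c - 1) * (1 + z + z ^ 2 * τ / 4) ^ (-(1 / 2) : ℝ))
      = ENNReal.ofReal (Real.Gamma c * Real.Gamma (1 - c)) * ∫⁻ w in Ioi (0 : ℝ),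
        ENNReal.ofReal (w ^ (c - 1) * (w - 1 - w ^ 2 * τ / 4) ^ (-(1 / 2) : ℝ)) := by
  have hΓ : 0 ≤ Real.Gamma c * Real.Gamma (1 - c) :=
    (mul_pos (Real.Gamma_pos_of_pos hc) (Real.Gamma_pos_of_pos (sub_pos.2 hc1))).le
  rw [← lintegral_const_mul _ (by fun_prop), ← lintegral_const_mul _ (by fun_prop)]
  calc _ = ∫⁻ z in Ioi (0 : ℝ), ∫⁻ w in Ioi (0 : ℝ), ENNReal.ofReal
          (z ^ (c - 1) * ((w - 1 - w ^ 2 * τ / 4) ^ (-(1 / 2) : ℝ) / (w + z))) := by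
        refine setLIntegral_congr_fun measurableSet_Ioi fun z (hz : 0 < z) => ?_
        have hz' : 0 ≤ z ^ (c - 1) := by positivity
        simp_rw [ENNReal.ofReal_mul hz']
        rw [lintegral_const_mul _ (by fun_prop), lintegral_quadratic_rpow_neg_half_div_add hτ hz,
          ENNReal.ofReal_mul Real.pi_pos.le]
        ring
    _ = ∫⁻ w in Ioi (0 : ℝ), ∫⁻ z in Ioi (0 : ℝ), ENNReal.ofReal
          (z ^ (c - 1) * ((w - 1 - w ^ 2 * τ / 4) ^ (-(1 / 2) : ℝ) / (w + z))) :=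
        lintegral_lintegral_swap (by fun_prop)
    _ = _ := by
        refine setLIntegral_congr_fun measurableSet_Ioi fun w (hw : 0 < w) => ?_
        have hq := rpow_neg_half_nonneg (w - 1 - w ^ 2 * τ / 4)
        have hcomm : ∀ z : ℝ, z ^ (c - 1) * ((w - 1 - w ^ 2 * τ / 4) ^ (-(1 / 2) : ℝ) / (w + z))
            = (w - 1 - w ^ 2 * τ / 4) ^ (-(1 / 2) : ℝ) * (z ^ (c - 1) / (w + z)) :=
          fun z => mul_div_left_comm _ _ _
        simp_rw [hcomm, ENNReal.ofReal_mul hq]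
        rw [lintegral_const_mul _ (by fun_prop), lintegral_rpow_div_add hc hc1 hw,
          ENNReal.ofReal_mul hΓ, mul_comm (w ^ (c - 1)), ENNReal.ofReal_mul hq]
        ring

theorem lintegral_add_rpow_mul_mul_rpow {a c s : ℝ} (hc : c = s + 2 * a) {k : ℝ → ℝ → ℝ}
    (hk : Measurable (Function.uncurry k)) :
    ∫⁻ x in Ioi (0 : ℝ), ∫⁻ y in Ioi (0 : ℝ),
        ENNReal.ofReal ((x + y) ^ s * (x * y) ^ (a - 1) * k (x + y) (x * y))
      = ∫⁻ τ in Ioo (0 : ℝ) 1,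
          ENNReal.ofReal (2 * 4 ^ (-a) * τ ^ (a - 1) * (1 - τ) ^ (-(1 / 2) : ℝ)) *
            ∫⁻ z in Ioi (0 : ℝ), ENNReal.ofReal (z ^ (c - 1) * k z (z ^ 2 * τ / 4)) := by
  have hkc : ∀ f g : ℝ × ℝ → ℝ, Measurable f → Measurable g → Measurable fun p => k (f p) (g p) :=
    fun f g hf hg => hk.comp (hf.prodMk hg)
  have hkz : ∀ τ : ℝ, Measurable fun z : ℝ => k z (z ^ 2 * τ / 4) := fun τ =>
    hk.comp (g := fun p : ℝ × ℝ => Function.uncurry k p) (measurable_id.prodMk (by fun_prop))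
  have hkp := hkc (fun p => p.1) (fun p => p.1 ^ 2 * p.2 / 4) (by fun_prop) (by fun_prop)
  rw [lintegral_Ioi_Ioi_comp_add_mul
    (H := fun z m => ENNReal.ofReal (z ^ s * m ^ (a - 1) * k z m))
    (by
      have := hkc (fun p => p.1) (fun p => p.2) (by fun_prop) (by fun_prop)
      exact Measurable.ennreal_ofReal (by fun_prop))]
  calc _ = ∫⁻ z in Ioi (0 : ℝ), ∫⁻ τ in Ioo (0 : ℝ) 1,
          ENNReal.ofReal (2 * 4 ^ (-a) * τ ^ (a - 1) * (1 - τ) ^ (-(1 / 2) : ℝ)) *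
            ENNReal.ofReal (z ^ (c - 1) * k z (z ^ 2 * τ / 4)) := by
        refine setLIntegral_congr_fun measurableSet_Ioi fun z (hz : 0 < z) =>
          setLIntegral_congr_fun measurableSet_Ioo fun τ hτ => ?_
        have h0 : 0 < τ := hτ.1
        have h1 : 0 < 1 - τ := sub_pos.2 hτ.2
        rw [← ENNReal.ofReal_mul (by positivity), ← ENNReal.ofReal_mul (by positivity)]
        congr 1
        have hz2 : (z ^ 2) ^ (a - 1) = z ^ (2 * a - 2) := by
          rw [← Real.rpow_natCast, ← Real.rpow_mul hz.le]
          congr 1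
          push_cast
          ring
        have h4 : (4 : ℝ) ^ (a - 1) * 4 ^ (-a) = 1 / 4 := by
          rw [← Real.rpow_add (by norm_num), show a - 1 + -a = (-1 : ℝ) by ring,
            Real.rpow_neg_one]
          norm_num
        have h4' : (4 : ℝ) ^ (-a) = 1 / 4 / 4 ^ (a - 1) := by
          rw [← h4]; field_simp
        have hzc : z ^ (c - 1) = z * z ^ s * z ^ (2 * a - 2) := by
          rw [hc, show s + 2 * a - 1 = 1 + s + (2 * a - 2) by ring, Real.rpow_add hz,
            Real.rpow_add hz, Real.rpow_one]
        rw [Real.div_rpow (by positivity) (by norm_num), Real.mul_rpow (by positivity) h0.le, hz2,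
          hzc, h4']
        field_simp
        ring
    _ = ∫⁻ τ in Ioo (0 : ℝ) 1, ∫⁻ z in Ioi (0 : ℝ),
          ENNReal.ofReal (2 * 4 ^ (-a) * τ ^ (a - 1) * (1 - τ) ^ (-(1 / 2) : ℝ)) *
            ENNReal.ofReal (z ^ (c - 1) * k z (z ^ 2 * τ / 4)) :=
        lintegral_lintegral_swap (Measurable.aemeasurable (by
          unfold Function.uncurry
          fun_prop))
    _ = _ := by
        refine setLIntegral_congr_fun measurableSet_Ioo fun τ _ => ?_
        have := hkz τ
        exact lintegral_const_mul _ (by fun_prop)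

theorem rpow_neg_half_add_sub_one_sub_mul (x y : ℝ) :
    (x + y - 1 - x * y) ^ (-(1 / 2) : ℝ)
      = (1 - x) ^ (-(1 / 2) : ℝ) * (y - 1) ^ (-(1 / 2) : ℝ)
        + (1 - y) ^ (-(1 / 2) : ℝ) * (x - 1) ^ (-(1 / 2) : ℝ) := by
  rcases le_total x 1 with hx | hx <;> rcases le_total y 1 with hy | hy
  · rw [rpow_neg_half_of_nonpos (x := y - 1) (by linarith),
      rpow_neg_half_of_nonpos (x := x - 1) (by linarith), rpow_neg_half_of_nonpos (by nlinarith)]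
    ring
  · rw [rpow_neg_half_of_nonpos (x := x - 1) (by linarith), mul_zero, add_zero,
      ← Real.mul_rpow (by linarith) (by linarith)]
    ring_nf
  · rw [rpow_neg_half_of_nonpos (x := y - 1) (by linarith), mul_zero, zero_add,
      ← Real.mul_rpow (by linarith) (by linarith)]
    ring_nf
  · rw [rpow_neg_half_of_nonpos (x := 1 - y) (by linarith),
      rpow_neg_half_of_nonpos (x := 1 - x) (by linarith), rpow_neg_half_of_nonpos (by nlinarith)]
    ring

/-- Substituting `y = 1 / u` makes the integrand over `0 < t < 1 < y` half of a symmetric function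
of `t` and `y`, which depends only on their sum and product. -/
theorem two_mul_lintegral_beta_inv_beta {a b s : ℝ} (hab : a + b = 1 / 2) :
    2 * ∫⁻ t in Ioo (0 : ℝ) 1, ∫⁻ u in Ioo (0 : ℝ) 1,
        ENNReal.ofReal (t ^ (a - 1) * (1 - t) ^ (-(1 / 2) : ℝ)
          * u ^ (b - 1) * (1 - u) ^ (-(1 / 2) : ℝ) * (t + 1 / u) ^ s)
      = ∫⁻ x in Ioi (0 : ℝ), ∫⁻ y in Ioi (0 : ℝ),
        ENNReal.ofReal ((x + y) ^ s * (x * y) ^ (a - 1)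
          * (x + y - 1 - x * y) ^ (-(1 / 2) : ℝ)) := by
  set G : ℝ → ℝ → ENNReal := fun x y => ENNReal.ofReal ((x + y) ^ s * (x * y) ^ (a - 1)
    * ((1 - x) ^ (-(1 / 2) : ℝ) * (y - 1) ^ (-(1 / 2) : ℝ))) with hG
  have hGm : Measurable (Function.uncurry G) := by
    unfold Function.uncurry; fun_prop
  have hinv : ∀ t ∈ Ioo (0 : ℝ) 1, ∫⁻ u in Ioo (0 : ℝ) 1,
      ENNReal.ofReal (t ^ (a - 1) * (1 - t) ^ (-(1 / 2) : ℝ)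
          * u ^ (b - 1) * (1 - u) ^ (-(1 / 2) : ℝ) * (t + 1 / u) ^ s)
      = ∫⁻ y in Ioi (0 : ℝ), G t y := by
    intro t ht
    have ht0 : 0 < t := ht.1
    have ht1 : 0 < 1 - t := sub_pos.2 ht.2
    rw [setLIntegral_eq_setLIntegral_abs_deriv_mul_of_invOn (s := Ioi 1)
      (f := fun y => y⁻¹) (f' := fun y => -(y ^ 2)⁻¹) (g := fun u => u⁻¹) measurableSet_Ioi
      (fun y (hy : 1 < y) => hasDerivAt_inv (by positivity))]
    · rw [← lintegral_indicator measurableSet_Ioi, ← lintegral_indicator measurableSet_Ioi]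
      congr 1
      ext y
      rcases lt_or_ge 1 y with hy | hy
      · have hy0 : 0 < y := one_pos.trans hy
        have hy1 : 0 < y - 1 := sub_pos.2 hy
        rw [indicator_of_mem (show y ∈ Ioi 1 from hy), indicator_of_mem (show y ∈ Ioi 0 from hy0),
          ← ENNReal.ofReal_mul (abs_nonneg _), abs_neg, abs_of_pos (by positivity)]
        simp only [hG]
        congr 1
        have h1 : 1 - y⁻¹ = (y - 1) / y := by field_simp
        have h2 : y ^ (a - 1) = (y ^ 2)⁻¹ * y⁻¹ ^ (b - 1) * (y ^ (-(1 / 2) : ℝ))⁻¹ := by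
          rw [Real.inv_rpow hy0.le, ← Real.rpow_neg hy0.le, ← Real.rpow_neg hy0.le,
            ← Real.rpow_natCast, ← Real.rpow_neg hy0.le, ← Real.rpow_add hy0,
            ← Real.rpow_add hy0]
          congr 1
          push_cast
          linarith
        rw [h1, Real.div_rpow hy1.le hy0.le, one_div y⁻¹, inv_inv, Real.mul_rpow ht0.le hy0.le, h2]
        ring
      · rw [indicator_of_notMem (by simpa using hy)]
        refine (indicator_apply_eq_zero.2 fun _ => ?_).symm
        simp only [hG]
        rw [rpow_neg_half_of_nonpos (x := y - 1) (by linarith), mul_zero, mul_zero,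
          ENNReal.ofReal_zero]
    · intro y (hy : 1 < y)
      exact ⟨by positivity, inv_lt_one_of_one_lt₀ hy⟩
    · intro u hu
      exact (one_lt_inv₀ hu.1).2 hu.2
    · exact ⟨fun y _ => inv_inv y, fun u _ => inv_inv u⟩
  have hR : ∫⁻ t in Ioo (0 : ℝ) 1, ∫⁻ u in Ioo (0 : ℝ) 1,
        ENNReal.ofReal (t ^ (a - 1) * (1 - t) ^ (-(1 / 2) : ℝ)
          * u ^ (b - 1) * (1 - u) ^ (-(1 / 2) : ℝ) * (t + 1 / u) ^ s)
      = ∫⁻ x in Ioi (0 : ℝ), ∫⁻ y in Ioi (0 : ℝ), G x y := by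
    rw [setLIntegral_congr_fun measurableSet_Ioo hinv, ← lintegral_indicator measurableSet_Ioo,
      ← lintegral_indicator measurableSet_Ioi]
    congr 1
    ext x
    by_cases hx : x ∈ Ioo (0 : ℝ) 1
    · rw [indicator_of_mem hx, indicator_of_mem (show x ∈ Ioi 0 from hx.1)]
    · rw [indicator_of_notMem hx]
      refine (indicator_apply_eq_zero.2 fun (hx0 : 0 < x) => ?_).symm
      have hx1 : 1 ≤ x := not_lt.1 fun h => hx ⟨hx0, h⟩
      simp only [hG, rpow_neg_half_of_nonpos (x := 1 - x) (by linarith), zero_mul, mul_zero,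
        ENNReal.ofReal_zero, lintegral_zero]
  have hsum : ∀ x ∈ Ioi (0 : ℝ), ∫⁻ y in Ioi (0 : ℝ),
      ENNReal.ofReal ((x + y) ^ s * (x * y) ^ (a - 1) * (x + y - 1 - x * y) ^ (-(1 / 2) : ℝ))
      = (∫⁻ y in Ioi (0 : ℝ), G x y) + ∫⁻ y in Ioi (0 : ℝ), G y x := by
    intro x (hx : 0 < x)
    rw [← lintegral_add_left (f := fun y => G x y) (hGm.comp measurable_prodMk_left)]
    refine setLIntegral_congr_fun measurableSet_Ioi fun y (hy : 0 < y) => ?_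
    simp only [hG]
    have h1 := rpow_neg_half_nonneg (1 - x)
    have h2 := rpow_neg_half_nonneg (1 - y)
    have h3 := rpow_neg_half_nonneg (x - 1)
    have h4 := rpow_neg_half_nonneg (y - 1)
    rw [← ENNReal.ofReal_add (by positivity) (by positivity), rpow_neg_half_add_sub_one_sub_mul,
      add_comm y x, mul_comm y x, mul_add]
  rw [hR, setLIntegral_congr_fun measurableSet_Ioi hsum,
    lintegral_add_left hGm.lintegral_prod_right, two_mul]
  congr 1
  exact lintegral_lintegral_swap hGm.aemeasurable

theorem lintegral_beta_inv_beta_ne_top {a b s : ℝ} (ha : 0 < a) (hs : s < b) :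
    ∫⁻ t in Ioo (0 : ℝ) 1, ∫⁻ u in Ioo (0 : ℝ) 1,
        ENNReal.ofReal (t ^ (a - 1) * (1 - t) ^ (-(1 / 2) : ℝ)
          * u ^ (b - 1) * (1 - u) ^ (-(1 / 2) : ℝ) * (t + 1 / u) ^ s) ≠ ⊤ := by
  have hle : ∀ t ∈ Ioo (0 : ℝ) 1, ∫⁻ u in Ioo (0 : ℝ) 1,
        ENNReal.ofReal (t ^ (a - 1) * (1 - t) ^ (-(1 / 2) : ℝ)
          * u ^ (b - 1) * (1 - u) ^ (-(1 / 2) : ℝ) * (t + 1 / u) ^ s)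
      ≤ ENNReal.ofReal (t ^ (a - 1) * (1 - t) ^ ((1 / 2) - 1 : ℝ)) *
        ∫⁻ u in Ioo (0 : ℝ) 1, ENNReal.ofReal (2 ^ |s|) *
          ENNReal.ofReal (u ^ (b - s - 1) * (1 - u) ^ ((1 / 2) - 1 : ℝ)) := by
    intro t ht
    have ht0 : 0 < t := ht.1
    have ht1 : 0 < 1 - t := sub_pos.2 ht.2
    rw [← lintegral_const_mul _ (by fun_prop)]
    refine setLIntegral_mono' measurableSet_Ioo fun u hu => ?_
    have hu0 : 0 < u := hu.1
    have hu1 : 0 < 1 - u := sub_pos.2 hu.2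
    rw [← ENNReal.ofReal_mul (by positivity), ← ENNReal.ofReal_mul (by positivity)]
    refine ENNReal.ofReal_le_ofReal ?_
    have hfac : t + 1 / u = (1 + t * u) * u⁻¹ := by field_simp; ring
    have h1 : 1 ≤ 1 + t * u := by nlinarith [mul_pos ht0 hu0]
    have h2 : 1 + t * u ≤ 2 := by nlinarith [ht.2, hu.2]
    have hbound : (1 + t * u) ^ s ≤ 2 ^ |s| :=
      (Real.rpow_le_rpow_of_exponent_le h1 (le_abs_self s)).trans
        (Real.rpow_le_rpow (by linarith) h2 (abs_nonneg s))
    have hpow : u ^ (b - s - 1) = u ^ (b - 1) * u⁻¹ ^ s := by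
      rw [Real.inv_rpow hu0.le, ← Real.rpow_neg hu0.le, ← Real.rpow_add hu0]
      ring_nf
    rw [hfac, Real.mul_rpow (by linarith) (by positivity), hpow,
      show ((1 / 2) - 1 : ℝ) = -(1 / 2) by norm_num]
    calc _ = t ^ (a - 1) * (1 - t) ^ (-(1 / 2) : ℝ) * ((1 + t * u) ^ s *
          (u ^ (b - 1) * u⁻¹ ^ s * (1 - u) ^ (-(1 / 2) : ℝ))) := by ring
      _ ≤ _ := by gcongr
  refine ((setLIntegral_mono' measurableSet_Ioo hle).trans_lt ?_).ne
  rw [lintegral_mul_const _ (by fun_prop), lintegral_const_mul _ (by fun_prop),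
    lintegral_rpow_mul_one_sub_rpow ha (by norm_num),
    lintegral_rpow_mul_one_sub_rpow (sub_pos.2 hs) (by norm_num)]
  exact ENNReal.mul_lt_top ENNReal.ofReal_lt_top
    (ENNReal.mul_lt_top ENNReal.ofReal_lt_top ENNReal.ofReal_lt_top)

theorem pi_mul_lintegral_betaPrime {a b s : ℝ} (hab : a + b = 1 / 2) (hs1 : -2 * a < s)
    (hs2 : s < 2 * b) :
    ENNReal.ofReal Real.pi * ∫⁻ x in Ioi (0 : ℝ), ∫⁻ y in Ioi (0 : ℝ),
        ENNReal.ofReal ((x + y) ^ s * (x * y) ^ (a - 1)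
          * (1 + (x + y) + x * y) ^ (-(1 / 2) : ℝ))
      = ENNReal.ofReal (Real.Gamma (2 * a + s) * Real.Gamma (2 * b - s)) *
        (2 * ∫⁻ t in Ioo (0 : ℝ) 1, ∫⁻ u in Ioo (0 : ℝ) 1,
          ENNReal.ofReal (t ^ (a - 1) * (1 - t) ^ (-(1 / 2) : ℝ)
            * u ^ (b - 1) * (1 - u) ^ (-(1 / 2) : ℝ) * (t + 1 / u) ^ s)) := by
  have hc : 2 * a + s = s + 2 * a := add_comm _ _
  rw [two_mul_lintegral_beta_inv_beta hab,
    lintegral_add_rpow_mul_mul_rpow hc (k := fun z m => (1 + z + m) ^ (-(1 / 2) : ℝ))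
      (by unfold Function.uncurry; fun_prop),
    lintegral_add_rpow_mul_mul_rpow hc (k := fun z m => (z - 1 - m) ^ (-(1 / 2) : ℝ))
      (by unfold Function.uncurry; fun_prop),
    ← lintegral_const_mul' _ _ ENNReal.ofReal_ne_top,
    ← lintegral_const_mul' _ _ ENNReal.ofReal_ne_top]
  refine setLIntegral_congr_fun measurableSet_Ioo fun τ hτ => ?_
  rw [mul_left_comm, pi_mul_lintegral_rpow_mul_quadratic_rpow_neg_half (by linarith) (by linarith)
    hτ, show 1 - (2 * a + s) = 2 * b - s by linarith, mul_left_comm]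

/-- Mellin-transform form of Proposition (case `a + b = 1/2`):
`B'_{a,b} + B'_{a,b} = B'_{2a,2b} × (B_{a,1/2} + B_{b,1/2}⁻¹)` in law. -/
theorem betaPrime_conv_mellin_ab_half (a b s : ℝ) (ha : 0 < a) (hb : 0 < b)
    (hab : a + b = 1 / 2) (hs1 : -2 * a < s) (hs2 : s < b) :
    (∫ x in Ioi (0 : ℝ), ∫ y in Ioi (0 : ℝ),
        (x + y) ^ s * betaPrimeDensity a b x * betaPrimeDensity a b y)
      = (Real.Gamma (2 * a + s) * Real.Gamma (2 * b - s)
            / (Real.Gamma (2 * a) * Real.Gamma (2 * b)))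
        * (Real.Gamma (a + 1 / 2) * Real.Gamma (b + 1 / 2)
            / (Real.Gamma a * Real.Gamma b * Real.Gamma (1 / 2) ^ 2))
        * ∫ t in (0 : ℝ)..1, ∫ u in (0 : ℝ)..1,
            t ^ (a - 1) * (1 - t) ^ (-(1 / 2) : ℝ)
            * u ^ (b - 1) * (1 - u) ^ (-(1 / 2) : ℝ)
            * (t + 1 / u) ^ s := by
  have hfinR := lintegral_beta_inv_beta_ne_top ha hs2
  have hkey := pi_mul_lintegral_betaPrime hab hs1 (by linarith : s < 2 * b)
  have hfinL : ∫⁻ x in Ioi (0 : ℝ), ∫⁻ y in Ioi (0 : ℝ), ENNReal.ofReal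
      ((x + y) ^ s * (x * y) ^ (a - 1) * (1 + (x + y) + x * y) ^ (-(1 / 2) : ℝ)) ≠ ⊤ := by
    refine (ENNReal.lt_top_of_mul_ne_top_right (a := ENNReal.ofReal Real.pi) ?_
      (by simp [Real.pi_pos])).ne
    rw [hkey]
    exact ENNReal.mul_ne_top ENNReal.ofReal_ne_top (ENNReal.mul_ne_top (by simp) hfinR)
  have hRint := setIntegral_setIntegral_eq_toReal_lintegral measurableSet_Ioo measurableSet_Ioo
    (F := fun t u => t ^ (a - 1) * (1 - t) ^ (-(1 / 2) : ℝ)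
      * u ^ (b - 1) * (1 - u) ^ (-(1 / 2) : ℝ) * (t + 1 / u) ^ s)
    (by unfold Function.uncurry; fun_prop)
    (fun t ht u hu => by
      have h1 := ht.1
      have h2 := hu.1
      have h3 := rpow_neg_half_nonneg (1 - t)
      have h4 := rpow_neg_half_nonneg (1 - u)
      positivity) hfinR
  have hLint := setIntegral_setIntegral_eq_toReal_lintegral measurableSet_Ioi measurableSet_Ioi
    (F := fun x y => (x + y) ^ s * (x * y) ^ (a - 1) * (1 + (x + y) + x * y) ^ (-(1 / 2) : ℝ))
    (by unfold Function.uncurry; fun_prop)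
    (fun x (hx : 0 < x) y (hy : 0 < y) => by positivity) hfinL
  have hGs : 0 < Real.Gamma (2 * a + s) := Real.Gamma_pos_of_pos (by linarith)
  have hGs' : 0 < Real.Gamma (2 * b - s) := Real.Gamma_pos_of_pos (by linarith)
  have hreal := congrArg ENNReal.toReal hkey
  rw [ENNReal.toReal_mul, ENNReal.toReal_mul, ENNReal.toReal_mul,
    ENNReal.toReal_ofReal Real.pi_pos.le, ENNReal.toReal_ofReal (by positivity), ← hLint, ← hRint,
    ENNReal.toReal_ofNat] at hreal
  have hL : (∫ x in Ioi (0 : ℝ), ∫ y in Ioi (0 : ℝ),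
        (x + y) ^ s * betaPrimeDensity a b x * betaPrimeDensity a b y)
      = (Real.Gamma (1 / 2) / (Real.Gamma a * Real.Gamma b)) ^ 2 *
        ∫ x in Ioi (0 : ℝ), ∫ y in Ioi (0 : ℝ),
          (x + y) ^ s * (x * y) ^ (a - 1) * (1 + (x + y) + x * y) ^ (-(1 / 2) : ℝ) := by
    simp_rw [← integral_const_mul]
    refine setIntegral_congr_fun measurableSet_Ioi fun x (hx : 0 < x) =>
      setIntegral_congr_fun measurableSet_Ioi fun y (hy : 0 < y) => ?_
    simp only [betaPrimeDensity, hab]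
    rw [show 1 + (x + y) + x * y = (1 + x) * (1 + y) by ring,
      Real.mul_rpow hx.le hy.le, Real.mul_rpow (by positivity) (by positivity)]
    ring
  have hR : (∫ t in (0 : ℝ)..1, ∫ u in (0 : ℝ)..1,
        t ^ (a - 1) * (1 - t) ^ (-(1 / 2) : ℝ)
        * u ^ (b - 1) * (1 - u) ^ (-(1 / 2) : ℝ) * (t + 1 / u) ^ s)
      = ∫ t in Ioo (0 : ℝ) 1, ∫ u in Ioo (0 : ℝ) 1,
        t ^ (a - 1) * (1 - t) ^ (-(1 / 2) : ℝ)
        * u ^ (b - 1) * (1 - u) ^ (-(1 / 2) : ℝ) * (t + 1 / u) ^ s := by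
    simp_rw [intervalIntegral.integral_of_le zero_le_one, integral_Ioc_eq_integral_Ioo]
  have hGa : 0 < Real.Gamma a := Real.Gamma_pos_of_pos ha
  have hGb : 0 < Real.Gamma b := Real.Gamma_pos_of_pos hb
  have hG2a : 0 < Real.Gamma (2 * a) := Real.Gamma_pos_of_pos (by linarith)
  have hG2b : 0 < Real.Gamma (2 * b) := Real.Gamma_pos_of_pos (by linarith)
  have hpow : (2 : ℝ) ^ (1 - 2 * a) * 2 ^ (1 - 2 * b) = 2 := by
    rw [← Real.rpow_add two_pos, show 1 - 2 * a + (1 - 2 * b) = (1 : ℝ) by linarith,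
      Real.rpow_one]
  have hdup : Real.Gamma a * Real.Gamma b * (Real.Gamma (a + 1 / 2) * Real.Gamma (b + 1 / 2))
      = 2 * Real.pi * (Real.Gamma (2 * a) * Real.Gamma (2 * b)) := by
    have hda := Real.Gamma_mul_Gamma_add_half a
    have hdb := Real.Gamma_mul_Gamma_add_half b
    have hpi := Real.mul_self_sqrt Real.pi_pos.le
    calc _ = (Real.Gamma a * Real.Gamma (a + 1 / 2)) * (Real.Gamma b * Real.Gamma (b + 1 / 2)) := by
          ring
      _ = (2 ^ (1 - 2 * a) * 2 ^ (1 - 2 * b)) * (√Real.pi * √Real.pi) *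
          (Real.Gamma (2 * a) * Real.Gamma (2 * b)) := by rw [hda, hdb]; ring
      _ = _ := by rw [hpow, hpi]
  have hdup' : Real.Gamma (a + 1 / 2) * Real.Gamma (b + 1 / 2)
      = 2 * Real.pi * (Real.Gamma (2 * a) * Real.Gamma (2 * b)) / (Real.Gamma a * Real.Gamma b) := by
    rw [← hdup]; field_simp
  have hpi := Real.pi_pos
  rw [hL, hR, Real.Gamma_one_half_eq, div_pow, Real.sq_sqrt hpi.le, hdup', div_mul_eq_mul_div,
    hreal]
  field_simp
end
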